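/- arXiv:1809.00356 — 2 statements merged into one kernel-verified Lean document; each statement's English description precedes it below -/
import Mathlib

section
/- Let D be a division ring with center F, and let G be a subnormal subgroup of the multiplicative group D*. If G is solvable-by-finite (i.e., G has a solvable normal subgroup of finite index), then G is contained in F. -/
/-- A subgroup `H` of a group is subnormal if there is a finite chain of subgroups
from `H` up to the whole group, each normal in the next. -/
def IsSubnormal {Γ : Type*} [Group Γ] (H : Subgroup Γ) : Prop :=
  ∃ (k : ℕ) (s : ℕ → Subgroup Γ), s 0 = H ∧ s k = ⊤ ∧
    ∀ i < k, s i ≤ s (i + 1) ∧ ((s i).subgroupOf (s (i + 1))).Normal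

section
open Polynomial

namespace SBF

/-- conjugation by a nonzero element, as a ring endomorphism -/
def cj {D : Type*} [DivisionRing D] (a : D) (ha : a ≠ 0) : D →+* D where
  toFun y := a * y * a⁻¹
  map_one' := by simp [ha]
  map_zero' := by simp
  map_add' := by intro x y; simp [mul_add, add_mul]
  map_mul' := by intro x y; simp only [mul_assoc]; rw [inv_mul_cancel_left₀ ha]

theorem cj_apply {D : Type*} [DivisionRing D] (a : D) (ha : a ≠ 0) (y : D) :
    cj a ha y = a * y * a⁻¹ := rfl

/-- polynomials whose `i`-th coefficient lies in `E x^i` -/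
def RE {D : Type*} [DivisionRing D] (E : Subfield D) (x : D) (hx : x ≠ 0)
    (hE : ∀ e ∈ E, x * e * x⁻¹ ∈ E) : Subring D[X] where
  carrier := {p | ∀ i, p.coeff i * (x⁻¹) ^ i ∈ E}
  mul_mem' := by
    intro p q hp hq n
    have hE' : ∀ i : ℕ, ∀ e ∈ E, x ^ i * e * (x⁻¹) ^ i ∈ E := by
      intro i
      induction i with
      | zero => intro e he; simpa using he
      | succ i ih =>
        intro e he
        have := hE _ (ih e he)
        rw [pow_succ' x, pow_succ (x⁻¹)]
        simpa [mul_assoc] using this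
    rw [coeff_mul, Finset.sum_mul]
    refine sum_mem fun ij hij => ?_
    obtain ⟨i, j⟩ := ij
    have hn : i + j = n := by simpa using hij
    subst hn
    have h1 := E.mul_mem (hp i) (hE' i _ (hq j))
    have hxx : (x⁻¹) ^ i * x ^ i = 1 := by rw [inv_pow]; exact inv_mul_cancel₀ (pow_ne_zero _ hx)
    have : p.coeff i * q.coeff j * x⁻¹ ^ (i + j)
        = p.coeff i * (x⁻¹) ^ i * (x ^ i * (q.coeff j * (x⁻¹) ^ j) * (x⁻¹) ^ i) := by
      rw [add_comm i j, pow_add]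
      simp only [mul_assoc]
      rw [← mul_assoc (x⁻¹ ^ i) (x ^ i), hxx, one_mul]
    simp only
    rw [this]
    exact h1
  one_mem' := by
    intro i
    rw [coeff_one]
    split_ifs with h
    · subst h; simp
    · simp
  add_mem' := by
    intro p q hp hq i
    rw [coeff_add, add_mul]
    exact E.add_mem (hp i) (hq i)
  zero_mem' := by intro i; simp
  neg_mem' := by
    intro p hp i
    rw [coeff_neg, neg_mul]
    exact E.neg_mem (hp i)

theorem mem_RE {D : Type*} [DivisionRing D] {E : Subfield D} {x : D} {hx : x ≠ 0}
    {hE : ∀ e ∈ E, x * e * x⁻¹ ∈ E} {p : D[X]} :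
    p ∈ RE E x hx hE ↔ ∀ i, p.coeff i * (x⁻¹) ^ i ∈ E := Iff.rfl

theorem monomial_mem_RE {D : Type*} [DivisionRing D] {E : Subfield D} {x : D} {hx : x ≠ 0}
    {hE : ∀ e ∈ E, x * e * x⁻¹ ∈ E} (i : ℕ) {e : D} (he : e ∈ E) :
    monomial i (e * x ^ i) ∈ RE E x hx hE := by
  intro j
  rw [coeff_monomial]
  split_ifs with h
  · subst h
    rw [mul_assoc, inv_pow, mul_inv_cancel₀ (pow_ne_zero _ hx), mul_one]; exact he
  · simp

theorem mem_span_RE {D : Type*} [DivisionRing D] {E : Subfield D} {x : D} {hx : x ≠ 0}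
    {hE : ∀ e ∈ E, x * e * x⁻¹ ∈ E} {p : D[X]} (hp : p ∈ RE E x hx hE) (M : ℕ)
    (hM : p.natDegree < M) :
    p ∈ Submodule.span E (Set.range fun m : Fin M => (monomial (m : ℕ) (x ^ (m : ℕ)) : D[X])) := by
  rw [p.as_sum_range' M hM]
  refine Submodule.sum_mem _ fun i hi => ?_
  have hi' : i < M := by simpa using hi
  have : monomial i (p.coeff i) = (⟨_, hp i⟩ : E) • (monomial i (x ^ i) : D[X]) := by
    rw [smul_monomial]
    congr 1
    rw [Subfield.smul_def]
    simp only [smul_eq_mul]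
    rw [mul_assoc, inv_pow, inv_mul_cancel₀ (pow_ne_zero _ hx), mul_one]
  rw [this]
  exact Submodule.smul_mem _ _ (Submodule.subset_span ⟨⟨i, hi'⟩, rfl⟩)

theorem ore_RE {D : Type*} [DivisionRing D] {E : Subfield D} {x : D} {hx : x ≠ 0}
    {hE : ∀ e ∈ E, x * e * x⁻¹ ∈ E} {f g : D[X]} (hf : f ∈ RE E x hx hE) (hg : g ∈ RE E x hx hE)
    (hg0 : g ≠ 0) : ∃ f' ∈ RE E x hx hE, ∃ g' ∈ RE E x hx hE, g' ≠ 0 ∧ g' * f = f' * g := by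
  classical
  set d := max f.natDegree g.natDegree with hd
  let y : ℕ → D[X] := fun i => monomial i (x ^ i)
  have hy : ∀ i, y i ∈ RE E x hx hE := fun i => by
    simpa using monomial_mem_RE (hx := hx) (hE := hE) i E.one_mem
  let v : Fin (d + 1) ⊕ Fin (d + 1) → D[X] := Sum.elim (fun i => y i * f) (fun i => y i * g)
  have hdeg : ∀ i : Fin (d + 1), ∀ p : D[X], p.natDegree ≤ d → (y i * p).natDegree < 2 * d + 1 := by
    intro i p hp
    have h1 : (y i).natDegree ≤ i := natDegree_monomial_le _
    have h2 := natDegree_mul_le (p := y i) (q := p)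
    have := i.2
    omega
  have hnot : ¬ LinearIndependent E v := by
    intro hli
    have := linearIndependent_le_span' v hli
      (Set.range fun m : Fin (2 * d + 1) => (monomial (m : ℕ) (x ^ (m : ℕ)) : D[X])) ?_
    · have h2 := Fintype.card_range_le (fun m : Fin (2 * d + 1) => (monomial (m : ℕ) (x ^ (m : ℕ)) : D[X]))
      simp only [Cardinal.mk_fintype, Fintype.card_sum, Fintype.card_fin] at this h2
      have h3 := Nat.cast_le.mp this
      omega
    · rintro _ ⟨i, rfl⟩
      rcases i with i | i
      · exact mem_span_RE ((RE E x hx hE).mul_mem (hy i) hf) _ (hdeg i f (le_max_left _ _))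
      · exact mem_span_RE ((RE E x hx hE).mul_mem (hy i) hg) _ (hdeg i g (le_max_right _ _))
  rw [Fintype.not_linearIndependent_iff] at hnot
  obtain ⟨c, hc, i0, hi0⟩ := hnot
  rw [Fintype.sum_sum_type] at hc
  let G : (Fin (d + 1) → E) → D[X] := fun c => ∑ i, c i • y i
  have hG : ∀ c, G c ∈ RE E x hx hE := by
    intro c
    refine sum_mem fun i _ => ?_
    have : c i • y i = monomial (i : ℕ) ((c i : D) * x ^ (i : ℕ)) := by
      simp only [y]; rw [smul_monomial]; rfl
    rw [this]
    exact monomial_mem_RE _ (c i).2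
  have hG0 : ∀ c, G c = 0 → c = 0 := by
    intro c h
    funext i
    have := congrArg (fun p => coeff p (i : ℕ)) h
    simp only [G, y, finsetSum_coeff, coeff_smul, coeff_monomial, coeff_zero] at this
    rw [Finset.sum_eq_single i] at this
    · simp only [if_true, Subfield.smul_def, smul_eq_mul] at this
      have h2 := (mul_eq_zero.mp this).resolve_right (pow_ne_zero _ hx)
      exact Subtype.ext h2
    · intro b _ hb
      rw [if_neg (fun h => hb (Fin.ext h)), smul_zero]
    · simp
  have hmul : ∀ c p, ∑ i : Fin (d + 1), c i • (y i * p) = G c * p := by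
    intro c p
    simp only [G, Finset.sum_mul, smul_mul_assoc]
  simp only [v, Sum.elim_inl, Sum.elim_inr] at hc
  rw [hmul (fun i => c (Sum.inl i)) f, hmul (fun i => c (Sum.inr i)) g] at hc
  refine ⟨-G (fun i => c (Sum.inr i)), neg_mem (hG _), G (fun i => c (Sum.inl i)), hG _, ?_, ?_⟩
  · intro h0
    rw [h0, zero_mul, zero_add] at hc
    have h1 := (mul_eq_zero.mp hc).resolve_right hg0
    have e1 := hG0 _ h0
    have e2 := hG0 _ h1
    rcases i0 with i | i
    · exact hi0 (congrFun e1 i)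
    · exact hi0 (congrFun e2 i)
  · rw [neg_mul]; exact eq_neg_of_add_eq_zero_left hc

end SBF
end

section
open Polynomial

namespace SBF

/-- commutator with `a` -/
def ph {D : Type*} [DivisionRing D] (a y : D) : D := a * y * a⁻¹ * y⁻¹

/-- `σ - 1` -/
def dl {D : Type*} [DivisionRing D] (a y : D) : D := a * y * a⁻¹ - y

theorem ph_ne {D : Type*} [DivisionRing D] {a y : D} (ha : a ≠ 0) (hy : y ≠ 0) : ph a y ≠ 0 := by
  simp [ph, ha, hy]

theorem ph_iter_ne {D : Type*} [DivisionRing D] {a y : D} (ha : a ≠ 0) (hy : y ≠ 0) (j : ℕ) :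
    (ph a)^[j] y ≠ 0 := by
  induction j with
  | zero => simpa
  | succ j ih => rw [Function.iterate_succ_apply']; exact ph_ne ha ih

theorem eval_mul_c {D : Type*} [DivisionRing D] {t : D} (ht : ∀ z, t * z = z * t) (p q : D[X]) :
    eval t (p * q) = eval t p * eval t q :=
  eval₂_mul_noncomm _ _ fun k => (ht _).symm

theorem eval_map_cj {D : Type*} [DivisionRing D] {t : D} (ht : ∀ z, t * z = z * t) (a : D)
    (ha : a ≠ 0) (p : D[X]) :
    eval t (p.map (cj a ha)) = a * eval t p * a⁻¹ := by
  rw [eval_map, ← cj_apply a ha, eval, hom_eval₂]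
  congr 1
  rw [cj_apply, ← ht, mul_assoc, mul_inv_cancel₀ ha, mul_one]

theorem map_coe' {D : Type*} [DivisionRing D] (f : D →+* D) (p : D[X]) :
    ((p.map f : D[X]) : PowerSeries D) = PowerSeries.map f (p : PowerSeries D) := by
  ext i
  simp [Polynomial.coeff_coe, coeff_map, PowerSeries.coeff_map]

theorem map_mem_RE {D : Type*} [DivisionRing D] {E : Subfield D} {x : D} {hx : x ≠ 0}
    {hE : ∀ e ∈ E, x * e * x⁻¹ ∈ E} (a : D) (ha : a ≠ 0) (haE : ∀ e ∈ E, a * e * a⁻¹ ∈ E)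
    (hc : ph a x ∈ E) {p : D[X]} (hp : p ∈ RE E x hx hE) : p.map (cj a ha) ∈ RE E x hx hE := by
  intro i
  rw [coeff_map]
  have h1 : p.coeff i = (p.coeff i * x⁻¹ ^ i) * x ^ i := by
    rw [mul_assoc, inv_pow, inv_mul_cancel₀ (pow_ne_zero _ hx), mul_one]
  rw [h1, map_mul, mul_assoc]
  refine E.mul_mem (haE _ (hp i)) ?_
  rw [map_pow]
  clear h1
  have h2 : cj a ha x = ph a x * x := by rw [cj_apply, ph, mul_assoc _ x⁻¹, inv_mul_cancel₀ hx, mul_one]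
  rw [h2]
  induction i with
  | zero => simp
  | succ i ih =>
    have h3 := E.mul_mem hc (hE _ ih)
    rw [pow_succ', pow_succ (x⁻¹)]
    simpa only [mul_assoc] using h3

theorem key {D : Type*} [DivisionRing D] (E : Subfield D) (x : D) (hx : x ≠ 0)
    (hE : ∀ e ∈ E, x * e * x⁻¹ ∈ E) (a : D) (ha : a ≠ 0) (haE : ∀ e ∈ E, a * e * a⁻¹ ∈ E)
    (hc : ph a x ∈ E) (j : ℕ) :
    ∃ Q ∈ RE E x hx hE, ∃ P ∈ RE E x hx hE, Q ≠ 0 ∧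
      (∀ t : D, (∀ z, t * z = z * t) → 1 + t * x ≠ 0 →
        eval t Q * (ph a)^[j] (1 + t * x) = eval t P) ∧
      ∃ V : PowerSeries D, PowerSeries.constantCoeff V = 1 ∧
        PowerSeries.coeff 1 V = (dl a)^[j] x ∧ (Q : PowerSeries D) * V = (P : PowerSeries D) := by
  induction j with
  | zero =>
    have hm : (1 + monomial 1 x : D[X]) ∈ RE E x hx hE := by
      refine add_mem (one_mem _) ?_
      simpa using monomial_mem_RE (hx := hx) (hE := hE) 1 E.one_mem
    refine ⟨1, one_mem _, 1 + monomial 1 x, hm, one_ne_zero, ?_,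
      ((1 + monomial 1 x : D[X]) : PowerSeries D), ?_, ?_, ?_⟩
    · intro t ht _
      simp [eval_monomial, ht]
    · rw [← PowerSeries.coeff_zero_eq_constantCoeff_apply, Polynomial.coeff_coe]
      simp [coeff_monomial]
    · rw [Polynomial.coeff_coe]
      simp [coeff_one]
    · simp
  | succ j ih =>
    obtain ⟨Q, hQ, P, hP, hQ0, hev, V, hV0, hV1, hQV⟩ := ih
    set s := cj a ha with hs
    have hsQ : Q.map s ∈ RE E x hx hE := map_mem_RE a ha haE hc hQ
    have hsP : P.map s ∈ RE E x hx hE := map_mem_RE a ha haE hc hP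
    have hVu : V * PowerSeries.invOfUnit V 1 = 1 := PowerSeries.mul_invOfUnit V 1 (by simpa using hV0)
    have hVu' : PowerSeries.invOfUnit V 1 * V = 1 := PowerSeries.invOfUnit_mul V 1 (by simpa using hV0)
    have hP0 : P ≠ 0 := by
      rintro rfl
      have h1 : (Q : PowerSeries D) * V = 0 := by rw [hQV]; simp
      have h2 : (Q : PowerSeries D) = 0 := by
        have := congrArg (· * PowerSeries.invOfUnit V 1) h1
        simpa [mul_assoc, hVu] using this
      exact hQ0 (by simpa using h2)
    have hsinj : Function.Injective s := s.injective
    have hsQ0 : Q.map s ≠ 0 := (Polynomial.map_ne_zero_iff hsinj).mpr hQ0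
    obtain ⟨B, hB, A, hA, hA0, hAB⟩ := ore_RE hQ hsQ hsQ0
    -- `A * Q = B * σ Q`
    have hAP0 : A * P ≠ 0 := mul_ne_zero hA0 hP0
    obtain ⟨N, hN, M, hM, hM0, hMN⟩ := ore_RE ((RE E x hx hE).mul_mem hB hsP)
      ((RE E x hx hE).mul_mem hA hP) hAP0
    refine ⟨M * (A * Q), mul_mem hM (mul_mem hA hQ), N * (A * Q), mul_mem hN (mul_mem hA hQ),
      mul_ne_zero hM0 (mul_ne_zero hA0 hQ0), ?_, PowerSeries.map s V * PowerSeries.invOfUnit V 1,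
      ?_, ?_, ?_⟩
    · intro t ht h1
      have e := hev t ht h1
      set v := (ph a)^[j] (1 + t * x) with hv
      have hv0 : v ≠ 0 := ph_iter_ne ha h1 j
      rw [Function.iterate_succ_apply', ← hv, ph]
      have e1 : eval t (Q.map s) * (a * v * a⁻¹) = eval t (P.map s) := by
        rw [eval_map_cj ht, eval_map_cj ht, ← e]
        simp only [mul_assoc]
        rw [inv_mul_cancel_left₀ ha]
      have e2 : eval t (M * (A * Q)) * (a * v * a⁻¹) = eval t (N * (A * Q)) * v := by
        have l1 : eval t (M * (A * Q)) * (a * v * a⁻¹) = eval t (M * (B * P.map s)) := by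
          rw [hAB, eval_mul_c ht, eval_mul_c ht, eval_mul_c ht, eval_mul_c ht, ← e1]
          simp only [mul_assoc]
        have l2 : eval t (N * (A * Q)) * v = eval t (N * (A * P)) := by
          rw [eval_mul_c ht, eval_mul_c ht, eval_mul_c ht, eval_mul_c ht, ← e]
          simp only [mul_assoc]
        rw [l1, l2, hMN]
      rw [← mul_assoc, e2, mul_assoc, mul_inv_cancel₀ hv0, mul_one]
    · rw [map_mul, PowerSeries.constantCoeff_invOfUnit]
      rw [← PowerSeries.coeff_zero_eq_constantCoeff_apply, PowerSeries.coeff_map,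
        PowerSeries.coeff_zero_eq_constantCoeff_apply, hV0]
      simp
    · have h1 : (PowerSeries.map s V * PowerSeries.invOfUnit V 1) * V = PowerSeries.map s V := by
        rw [mul_assoc, hVu', mul_one]
      set W := PowerSeries.map s V * PowerSeries.invOfUnit V 1
      have hW0 : PowerSeries.constantCoeff W = 1 := by
        have := congrArg PowerSeries.constantCoeff h1
        rw [map_mul, hV0, mul_one] at this
        rw [this, ← PowerSeries.coeff_zero_eq_constantCoeff_apply, PowerSeries.coeff_map,
          PowerSeries.coeff_zero_eq_constantCoeff_apply, hV0, map_one]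
      have := congrArg (PowerSeries.coeff 1) h1
      rw [PowerSeries.coeff_mul, Finset.Nat.antidiagonal_succ] at this
      simp [hW0, hV0, hV1] at this
      rw [Function.iterate_succ_apply', dl, eq_sub_iff_add_eq, add_comm, this]
      rfl
    · have e1 : ((Q.map s : D[X]) : PowerSeries D) * PowerSeries.map s V
          = ((P.map s : D[X]) : PowerSeries D) := by
        rw [map_coe', map_coe', ← hQV, map_mul]
      have l1 : ((M * (A * Q) : D[X]) : PowerSeries D) * PowerSeries.map s V
          = ((N * (A * Q) : D[X]) : PowerSeries D) * V := by
        have l1 : ((M * (A * Q) : D[X]) : PowerSeries D) * PowerSeries.map s V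
            = ((M * (B * P.map s) : D[X]) : PowerSeries D) := by
          rw [hAB, coe_mul, coe_mul, coe_mul, coe_mul, ← e1]
          simp only [mul_assoc]
        have l2 : ((N * (A * Q) : D[X]) : PowerSeries D) * V
            = ((N * (A * P) : D[X]) : PowerSeries D) := by
          rw [coe_mul, coe_mul, coe_mul, coe_mul, ← hQV]
          simp only [mul_assoc]
        rw [l1, l2, hMN]
      rw [← mul_assoc, l1, mul_assoc, hVu, mul_one]

theorem main_lemma {D : Type*} [DivisionRing D] (E : Subfield D) (x : D) (hx : x ≠ 0)
    (hE : ∀ e ∈ E, x * e * x⁻¹ ∈ E) (a : D) (ha : a ≠ 0) (haE : ∀ e ∈ E, a * e * a⁻¹ ∈ E)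
    (hc : ph a x ∈ E) (j : ℕ) (T : Set D) (hT : ∀ t ∈ T, ∀ z, t * z = z * t)
    (hT1 : ∀ t ∈ T, 1 + t * x ≠ 0)
    (hinj : ∀ p ∈ RE E x hx hE, (∀ t ∈ T, eval t p = 0) → p = 0)
    (hd : (dl a)^[j] x ≠ 0) (h : D) (hh : h ∈ E)
    (hconst : ∀ t ∈ T, (ph a)^[j] (1 + t * x) = h) : False := by
  obtain ⟨Q, hQ, P, hP, hQ0, hev, V, hV0, hV1, hQV⟩ := key E x hx hE a ha haE hc j
  have hC : (C h : D[X]) ∈ RE E x hx hE := by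
    simpa using monomial_mem_RE (hx := hx) (hE := hE) 0 hh
  have h0 : Q * C h - P = 0 := by
    refine hinj _ (sub_mem (mul_mem hQ hC) hP) ?_
    intro t ht
    rw [eval_sub, eval_mul_c (hT t ht), eval_C, ← hev t (hT t ht) (hT1 t ht), hconst t ht, sub_self]
  have h1 : (Q : PowerSeries D) * (V - PowerSeries.C h) = 0 := by
    rw [mul_sub, hQV, ← sub_eq_zero.mp h0, coe_mul, coe_C, sub_self]
  have h2 : (Q : PowerSeries D) ≠ 0 := by simpa using hQ0
  have h3 := sub_eq_zero.mp ((mul_eq_zero.mp h1).resolve_left h2)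
  apply hd
  rw [← hV1, h3, PowerSeries.coeff_C]
  simp

/-- a polynomial vanishing at infinitely many central points is zero -/
theorem eq_zero_of_infinite {D : Type*} [DivisionRing D] (T : Set D)
    (hT : ∀ t ∈ T, ∀ z, t * z = z * t) (hinf : T.Infinite) (p : D[X])
    (hp : ∀ t ∈ T, eval t p = 0) : p = 0 := by
  suffices H : ∀ n : ℕ, ∀ T : Set D, (∀ t ∈ T, ∀ z, t * z = z * t) → T.Infinite → ∀ p : D[X],
      p.natDegree ≤ n → (∀ t ∈ T, eval t p = 0) → p = 0 from H _ T hT hinf p le_rfl hp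
  clear hp p hinf hT T
  intro n
  induction n with
  | zero =>
    intro T hT hinf p hn hp
    obtain ⟨t, ht⟩ := hinf.nonempty
    rw [eq_C_of_natDegree_le_zero hn] at hp ⊢
    simpa using hp t ht
  | succ n ih =>
    intro T hT hinf p hn hp
    obtain ⟨t, ht⟩ := hinf.nonempty
    have hm := monic_X_sub_C t
    have hdiv := modByMonic_add_div p (X - C t)
    set q := p /ₘ (X - C t) with hq
    have hr : (p %ₘ (X - C t)).natDegree = 0 := by
      have := natDegree_modByMonic_lt p hm (by
        intro h; have := congrArg natDegree h; simp at this)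
      rw [natDegree_X_sub_C] at this
      omega
    obtain ⟨r, hr'⟩ : ∃ r, p %ₘ (X - C t) = C r := ⟨_, eq_C_of_natDegree_eq_zero hr⟩
    rw [hr'] at hdiv
    have hr0 : r = 0 := by
      have h1 := hp t ht
      rw [← hdiv, eval_add, eval_mul_c (hT t ht)] at h1
      simpa using h1
    rw [hr0, map_zero, zero_add] at hdiv
    have hq0 : q = 0 := by
      refine ih (T \ {t}) (fun s hs => hT s hs.1) (hinf.sdiff (Set.finite_singleton t)) q ?_ ?_
      · rw [hq, natDegree_divByMonic p hm, natDegree_X_sub_C]; omega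
      · intro s hs
        have h1 := hp s hs.1
        rw [← hdiv, eval_mul_c (hT s hs.1)] at h1
        refine (mul_eq_zero.mp h1).resolve_left ?_
        simp only [eval_sub, eval_X, eval_C]
        exact sub_ne_zero.mpr hs.2
    rw [← hdiv, hq0, mul_zero]

end SBF
end

section
open Polynomial

namespace SBF

/-- subnormal chains -/
inductive Ch {Γ : Type*} [Group Γ] : ℕ → Subgroup Γ → Prop
  | top : Ch 0 ⊤
  | step {n : ℕ} {H K : Subgroup Γ} : H ≤ K → (∀ k ∈ K, ∀ h ∈ H, k * h * k⁻¹ ∈ H) → Ch n K →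
      Ch (n + 1) H

theorem Ch.comap {Γ Γ' : Type*} [Group Γ] [Group Γ'] (f : Γ' →* Γ) {n : ℕ} {H : Subgroup Γ}
    (h : Ch n H) : Ch n (H.comap f) := by
  induction h with
  | top => rw [Subgroup.comap_top]; exact Ch.top
  | step hle hn _ ih =>
    refine Ch.step (Subgroup.comap_mono hle) ?_ ih
    intro k hk h hh
    rw [Subgroup.mem_comap] at *
    simpa using hn _ hk _ hh

theorem Ch.engel {D : Type*} [DivisionRing D] {n : ℕ} {G : Subgroup Dˣ} (h : Ch n G) {a : Dˣ}
    (ha : a ∈ G) {v : D} (hv : v ≠ 0) : ∃ g ∈ G, (ph (a : D))^[n] v = (g : D) := by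
  induction h with
  | top => exact ⟨Units.mk0 v hv, trivial, rfl⟩
  | step hle hn _ ih =>
    obtain ⟨g, hg, e⟩ := ih (hle ha)
    refine ⟨a * (g * a⁻¹ * g⁻¹), mul_mem ha (hn _ hg _ (inv_mem ha)), ?_⟩
    rw [Function.iterate_succ_apply', e, ph]
    simp [mul_assoc]

theorem ph_eq_one_iff {D : Type*} [DivisionRing D] {a y : D} (ha : a ≠ 0) (hy : y ≠ 0) :
    ph a y = 1 ↔ a * y = y * a := by
  rw [ph, mul_inv_eq_one₀ hy, mul_inv_eq_iff_eq_mul₀ ha]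

theorem dl_iter {D : Type*} [DivisionRing D] {a x c : D} (ha : a ≠ 0) (hx : x ≠ 0)
    (hc : c = ph a x) (hac : a * c = c * a) (j : ℕ) : (dl a)^[j] x = (c - 1) ^ j * x := by
  induction j with
  | zero => simp
  | succ j ih =>
    rw [Function.iterate_succ_apply', ih, dl]
    have h1 : Commute a ((c - 1) ^ j) := by
      refine Commute.pow_right ?_ j
      exact Commute.sub_right hac (Commute.one_right a)
    have h2 : a * x * a⁻¹ = c * x := by
      rw [hc, ph, mul_assoc _ x⁻¹, inv_mul_cancel₀ hx, mul_one]
    rw [← mul_assoc, h1.eq, mul_assoc _ a, mul_assoc, h2, pow_succ]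
    noncomm_ring

theorem one_add_ne {D : Type*} [DivisionRing D] {a x t : D} (ht : ∀ z, t * z = z * t)
    (hax : a * x ≠ x * a) : 1 + t * x ≠ 0 := by
  intro h
  have ht0 : t ≠ 0 := by rintro rfl; simp at h
  have h1 : t * x = -1 := by rw [eq_neg_iff_add_eq_zero, add_comm]; exact h
  apply hax
  apply mul_left_cancel₀ ht0
  rw [← mul_assoc, ht a, mul_assoc, h1, ← mul_assoc, h1]
  simp

theorem central_of_infinite {D : Type*} [DivisionRing D]
    (hinf : {t : D | ∀ z, t * z = z * t}.Infinite) {n : ℕ} {G : Subgroup Dˣ} (hG : Ch n G)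
    (hab : ∀ g ∈ G, ∀ h ∈ G, g * h = h * g) {a : Dˣ} (ha : a ∈ G) (z : D) :
    (a : D) * z = z * a := by
  classical
  by_contra hz
  have ha0 : (a : D) ≠ 0 := a.ne_zero
  have hz0 : z ≠ 0 := by rintro rfl; simp at hz
  have hex : ∃ m, ∀ v : D, v ≠ 0 → (ph (a : D))^[m] v = 1 := by
    refine ⟨n + 1, fun v hv => ?_⟩
    obtain ⟨g, hg, e⟩ := hG.engel ha hv
    rw [Function.iterate_succ_apply', e, ph_eq_one_iff ha0 g.ne_zero]
    exact_mod_cast congrArg Units.val (hab a ha g hg)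
  have hphz : ph (a : D) z ≠ 1 := fun h => hz ((ph_eq_one_iff ha0 hz0).mp h)
  obtain ⟨m, hm⟩ : ∃ m, Nat.find hex = m := ⟨_, rfl⟩
  have hspec := Nat.find_spec hex
  rw [hm] at hspec
  rcases m with _ | _ | m
  · exact hphz (hspec _ (ph_ne ha0 hz0))
  · exact hphz (hspec z hz0)
  · have hmin := Nat.find_min hex (m := m + 1) (by omega)
    push Not at hmin
    obtain ⟨y, hy0, hy⟩ := hmin
    rw [Function.iterate_succ_apply'] at hy
    have h2 := hspec y hy0
    rw [Function.iterate_succ_apply', Function.iterate_succ_apply'] at h2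
    have hx0 : (ph (a : D))^[m] y ≠ 0 := ph_iter_ne ha0 hy0 m
    generalize (ph (a : D))^[m] y = x at *
    have hac := (ph_eq_one_iff ha0 (ph_ne ha0 hx0)).mp h2
    have hax : (a : D) * x ≠ x * a := fun h => hy ((ph_eq_one_iff ha0 hx0).mpr h)
    refine main_lemma ⊤ x hx0 (fun _ _ => trivial) (a : D) ha0 (fun _ _ => trivial) trivial (m + 2)
      _ (fun t ht => ht) (fun t ht => one_add_ne ht hax)
      (fun p _ hp => eq_zero_of_infinite _ (fun t ht => ht) hinf p hp) ?_ 1 trivial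
      (fun t ht => hspec _ (one_add_ne ht hax))
    rw [dl_iter ha0 hx0 rfl hac]
    exact mul_ne_zero (pow_ne_zero _ (sub_ne_zero.mpr hy)) hx0

theorem central_of_finite_charZero {D : Type*} [DivisionRing D] [CharZero D]
    {n : ℕ} {G : Subgroup Dˣ} (hG : Ch n G) [Finite G] {a : Dˣ} (ha : a ∈ G) (z : D) :
    (a : D) * z = z * a := by
  classical
  by_contra hz
  have ha0 : (a : D) ≠ 0 := a.ne_zero
  have hz0 : z ≠ 0 := by rintro rfl; simp at hz
  have hdz : ∀ j, (dl (a : D))^[j] z ≠ 0 := by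
    intro j hj
    have hex : ∃ j, (dl (a : D))^[j] z = 0 := ⟨j, hj⟩
    obtain ⟨m, hm⟩ : ∃ m, Nat.find hex = m := ⟨_, rfl⟩
    have hspec := Nat.find_spec hex
    rw [hm] at hspec
    rcases m with _ | _ | m
    · exact hz0 hspec
    · apply hz
      have : (a : D) * z * (a : D)⁻¹ - z = 0 := hspec
      rwa [sub_eq_zero, mul_inv_eq_iff_eq_mul₀ ha0] at this
    · have hmin := Nat.find_min hex (m := m + 1) (by omega)
      rw [Function.iterate_succ_apply'] at hmin
      rw [Function.iterate_succ_apply', Function.iterate_succ_apply'] at hspec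
      generalize (dl (a : D))^[m] z = u at *
      obtain ⟨w, hw⟩ : ∃ w, dl (a : D) u = w := ⟨_, rfl⟩
      rw [hw] at hmin hspec
      have h1 : (a : D) * u * (a : D)⁻¹ = u + w := by
        rw [← hw, dl]; abel
      have h2 : (a : D) * w * (a : D)⁻¹ = w := by
        rw [dl, sub_eq_zero] at hspec; exact hspec
      have h3 : ∀ i : ℕ, (a : D) ^ i * u * (a : D)⁻¹ ^ i = u + i * w := by
        intro i
        induction i with
        | zero => simp
        | succ i ih =>
          have e : (a : D) ^ (i + 1) * u * (a : D)⁻¹ ^ (i + 1)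
              = a * ((a : D) ^ i * u * (a : D)⁻¹ ^ i) * (a : D)⁻¹ := by
            rw [pow_succ' (a : D), pow_succ (a : D)⁻¹]; simp only [mul_assoc]
          rw [e, ih, mul_add, add_mul, h1]
          have e2 : (a : D) * (i * w) * (a : D)⁻¹ = i * w := by
            rw [← mul_assoc, ← (Nat.cast_commute i (a : D)).eq, mul_assoc (i : D), mul_assoc (i : D), h2]
          rw [e2]
          push_cast
          noncomm_ring
      have hfo : IsOfFinOrder (⟨a, ha⟩ : G) := isOfFinOrder_of_finite _
      obtain ⟨N, hN, haN⟩ := isOfFinOrder_iff_pow_eq_one.mp hfo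
      have haN' : (a : D) ^ N = 1 := by
        have := congrArg (fun g : G => ((g : Dˣ) : D)) haN
        simpa using this
      have h4 := h3 N
      rw [inv_pow, haN'] at h4
      simp at h4
      rcases h4 with h4 | h4
      · omega
      · exact hmin h4
  let f : ℕ → G := fun t =>
    ⟨_, (hG.engel ha (one_add_ne (t := (t : D)) (fun z => (Nat.cast_commute t z).eq) hz)).choose_spec.1⟩
  have hf : ∀ t : ℕ, (ph (a : D))^[n] (1 + (t : D) * z) = ((f t : Dˣ) : D) := fun t =>
    (hG.engel ha (one_add_ne (t := (t : D)) (fun z => (Nat.cast_commute t z).eq) hz)).choose_spec.2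
  obtain ⟨g, hg⟩ := Finite.exists_infinite_fiber f
  have hT : ∀ t ∈ (Nat.cast '' (f ⁻¹' {g}) : Set D), ∀ z, t * z = z * t := by
    rintro _ ⟨t, _, rfl⟩ z
    exact (Nat.cast_commute t z).eq
  refine main_lemma ⊤ z hz0 (fun _ _ => trivial) (a : D) ha0 (fun _ _ => trivial) trivial n
    (Nat.cast '' (f ⁻¹' {g})) hT (fun t ht => one_add_ne (hT t ht) hz)
    (fun p _ hp => eq_zero_of_infinite _ hT
      ((Set.infinite_coe_iff.mp hg).image Nat.cast_injective.injOn) p hp) (hdz n) ((g : Dˣ) : D) trivial ?_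
  rintro _ ⟨t, ht, rfl⟩
  rw [hf t, show f t = g from ht]

/-- Dedekind-type independence of the powers of `x` -/
theorem indep {D : Type*} [DivisionRing D] {x a : D} (hx : x ≠ 0) (b : ℕ → D)
    (hb : ∀ i, x ^ i * a = b i * x ^ i) (hbb : ∀ i j, b i * b j = b j * b i)
    (hinj : Function.Injective b) (s : Finset ℕ) : ∀ e : ℕ → D, (∀ i j, e i * b j = b j * e i) →
      ∑ i ∈ s, e i * x ^ i = 0 → ∀ i ∈ s, e i = 0 := by
  induction s using Finset.induction_on with
  | empty => intro e _ _ i hi; simp at hi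
  | insert n s hn ih =>
    intro e he hsum
    have h1 : ∑ i ∈ insert n s, e i * (b i - b n) * x ^ i = 0 := by
      have h2 : (∑ i ∈ insert n s, e i * x ^ i) * a - b n * (∑ i ∈ insert n s, e i * x ^ i) = 0 := by
        rw [hsum]; simp
      rw [← h2, Finset.sum_mul, Finset.mul_sum, ← Finset.sum_sub_distrib]
      refine Finset.sum_congr rfl fun i _ => ?_
      rw [mul_assoc (e i) (x ^ i) a, hb, ← mul_assoc (b n), ← he i n]
      noncomm_ring
    rw [Finset.sum_insert hn, sub_self, mul_zero, zero_mul, zero_add] at h1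
    have h3 := ih (fun i => e i * (b i - b n)) (by
      intro i j
      have c1 : Commute (e i) (b j) := he i j
      have c2 : Commute (b i - b n) (b j) := Commute.sub_left (hbb i j) (hbb n j)
      exact (c1.mul_left c2).eq) h1
    have h4 : ∀ i ∈ s, e i = 0 := by
      intro i hi
      refine (mul_eq_zero.mp (h3 i hi)).resolve_right (sub_ne_zero.mpr ?_)
      intro h
      exact hn (hinj h ▸ hi)
    intro i hi
    rcases Finset.mem_insert.mp hi with rfl | hi
    · rw [Finset.sum_insert hn, Finset.sum_eq_zero (s := s), add_zero] at hsum
      · exact (mul_eq_zero.mp hsum).resolve_right (pow_ne_zero _ hx)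
      · intro k hk; rw [h4 k hk, zero_mul]
    · exact h4 i hi

/-- centralizer as a division subring -/
def cent {D : Type*} [DivisionRing D] (S : Set D) : Subfield D :=
  { Subring.centralizer S with
    inv_mem' := by
      intro y hy g hg
      have : g * y = y * g := hy g hg
      exact (Commute.inv_right₀ this).eq }

theorem mem_cent {D : Type*} [DivisionRing D] {S : Set D} {y : D} :
    y ∈ cent S ↔ ∀ g ∈ S, g * y = y * g := Iff.rfl

theorem exists_pow_comm {D : Type*} [DivisionRing D] {n : ℕ} {G : Subgroup Dˣ} (hG : Ch n G)
    (hab : ∀ g ∈ G, ∀ h ∈ G, g * h = h * g) {a x : Dˣ} (ha : a ∈ G)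
    (hxG : ∀ g ∈ G, x * g * x⁻¹ ∈ G) (hxG' : ∀ g ∈ G, x⁻¹ * g * x ∈ G) (hax : a * x ≠ x * a) :
    ∃ N, 0 < N ∧ x ^ N * a = a * x ^ N := by
  by_contra hno
  push Not at hno
  have ha0 : (a : D) ≠ 0 := a.ne_zero
  have hx0 : (x : D) ≠ 0 := x.ne_zero
  have habD : ∀ g ∈ G, ∀ h ∈ G, (g : D) * h = h * g := fun g hg h hh =>
    congrArg Units.val (hab g hg h hh)
  let S : Set D := Units.val '' (G : Set Dˣ)
  have hGE : ∀ g ∈ G, (g : D) ∈ cent S := by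
    rintro g hg _ ⟨h, hh, rfl⟩
    exact habD h hh g hg
  have hxpow : ∀ i : ℕ, ∀ g ∈ G, x ^ i * g * (x ^ i)⁻¹ ∈ G := by
    intro i
    induction i with
    | zero => intro g hg; simpa using hg
    | succ i ih =>
      intro g hg
      have := hxG _ (ih g hg)
      rw [pow_succ']
      simpa [mul_assoc] using this
  have hxE : ∀ e ∈ cent S, (x : D) * e * (x : D)⁻¹ ∈ cent S := by
    rintro e he _ ⟨g, hg, rfl⟩
    have h1 := he _ ⟨_, hxG' g hg, rfl⟩
    simp only [Units.val_mul, Units.val_inv_eq_inv_val] at h1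
    have h2 : (x : D) * ((x : D)⁻¹ * g * x * e) * (x : D)⁻¹ = x * (e * ((x : D)⁻¹ * g * x)) * (x : D)⁻¹ := by
      rw [h1]
    simp only [mul_assoc] at h2 ⊢
    rw [mul_inv_cancel_left₀ hx0, mul_inv_cancel₀ hx0, mul_one] at h2
    exact h2
  have haE : ∀ e ∈ cent S, (a : D) * e * (a : D)⁻¹ ∈ cent S := fun e he =>
    mul_mem (mul_mem (hGE a ha) he) (inv_mem (hGE a ha))
  have hcG : a * (x * a⁻¹ * x⁻¹) ∈ G := mul_mem ha (hxG _ (inv_mem ha))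
  have hceq : ph (a : D) x = ((a * (x * a⁻¹ * x⁻¹) : Dˣ) : D) := by simp [ph, mul_assoc]
  have hcE : ph (a : D) x ∈ cent S := by rw [hceq]; exact hGE _ hcG
  have haxD : (a : D) * x ≠ x * a := fun h => hax (Units.ext h)
  have hc1 : ph (a : D) x ≠ 1 := fun h => haxD ((ph_eq_one_iff ha0 hx0).mp h)
  have hac : (a : D) * ph (a : D) x = ph (a : D) x * a := by
    rw [hceq]; exact habD _ ha _ hcG
  let b : ℕ → Dˣ := fun i => x ^ i * a * (x ^ i)⁻¹
  have hbG : ∀ i, b i ∈ G := fun i => hxpow i a ha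
  have hbinj : Function.Injective b := by
    have key : ∀ i j, i < j → b i ≠ b j := by
      intro i j hij h
      apply hno (j - i) (by omega)
      simp only [b] at h
      have hj : j = i + (j - i) := by omega
      generalize j - i = k at *
      subst hj
      rw [pow_add] at h
      have h2 := congrArg (fun u => (x ^ i)⁻¹ * u * x ^ i * x ^ k) h
      simp only [mul_assoc, mul_inv_rev, inv_mul_cancel_left, inv_mul_cancel, mul_one] at h2
      exact h2.symm
    intro i j h
    rcases lt_trichotomy i j with h1 | h1 | h1
    · exact absurd h (key _ _ h1)
    · exact h1
    · exact absurd h.symm (key _ _ h1)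
  refine main_lemma (cent S) x hx0 hxE a ha0 haE hcE (n + 1) {1} (by simp) ?_ ?_ ?_ 1 (one_mem _) ?_
  · rintro _ rfl; exact one_add_ne (by simp) haxD
  · intro p hp h1
    have h2 := h1 1 rfl
    rw [eval_eq_sum_range] at h2
    have h3 := indep hx0 (fun i => (b i : D)) (a := (a : D)) (by
      intro i; simp [b, mul_assoc]) (fun i j => habD _ (hbG i) _ (hbG j))
      (fun i j h => hbinj (Units.ext h)) (Finset.range (p.natDegree + 1))
      (fun i => p.coeff i * (x : D)⁻¹ ^ i) (by
        intro i j
        exact (hp i _ ⟨_, hbG j, rfl⟩).symm) (by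
        rw [← h2]
        refine Finset.sum_congr rfl fun i _ => ?_
        rw [mul_assoc, inv_pow, inv_mul_cancel₀ (pow_ne_zero _ hx0)]; simp)
    ext i
    by_cases hi : i < p.natDegree + 1
    · have := h3 i (by simpa using hi)
      have h4 := (mul_eq_zero.mp this).resolve_right (pow_ne_zero _ (inv_ne_zero hx0))
      simpa using h4
    · rw [coeff_eq_zero_of_natDegree_lt (by omega)]; simp
  · rw [dl_iter ha0 hx0 rfl hac]
    exact mul_ne_zero (pow_ne_zero _ (sub_ne_zero.mpr hc1)) hx0
  · rintro t rfl
    obtain ⟨g, hg, e⟩ := hG.engel ha (one_add_ne (t := (1 : D)) (by simp) haxD)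
    rw [Function.iterate_succ_apply', e, ph_eq_one_iff ha0 g.ne_zero]
    exact habD a ha g hg

theorem finite_center {D : Type*} [DivisionRing D] {n : ℕ} {G : Subgroup Dˣ} (hG : Ch n G)
    (hab : ∀ g ∈ G, ∀ h ∈ G, g * h = h * g) {a x : Dˣ} (ha : a ∈ G) (hax : a * x ≠ x * a) :
    {z : D | z ∈ cent {(a : D), (x : D)} ∧
      z ∈ cent (cent {(a : D), (x : D)} : Set D)}.Finite := by
  by_contra hinf
  set L := cent (cent {(a : D), (x : D)} : Set D) with hL
  have haL : (a : D) ∈ L := by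
    intro g hg
    exact (hg _ (by simp)).symm
  have hxL : (x : D) ∈ L := by
    intro g hg
    exact (hg _ (by simp)).symm
  let a' : Lˣ := Units.mk0 ⟨a, haL⟩ (fun h => a.ne_zero (congrArg Subtype.val h))
  have hm : ∀ u : Lˣ, ((Units.map (L.subtype : L →* D) u : Dˣ) : D) = ((u : L) : D) := fun u => rfl
  have ha' : Units.map (L.subtype : L →* D) a' = a := Units.ext rfl
  have := central_of_infinite (D := L) ?_ (hG.comap (Units.map (L.subtype : L →* D))) ?_ (a := a')
    (by rw [Subgroup.mem_comap, ha']; exact ha) ⟨x, hxL⟩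
  · apply hax
    apply Units.ext
    exact congrArg Subtype.val this
  · intro hfin
    apply hinf
    refine (hfin.image Subtype.val).subset ?_
    rintro z ⟨hz1, hz2⟩
    refine ⟨⟨z, hz2⟩, ?_, rfl⟩
    rintro ⟨w, hw⟩
    exact Subtype.ext (hw z hz1)
  · intro g hg h hh
    have := hab _ hg _ hh
    apply Units.ext
    apply Subtype.ext
    exact congrArg Units.val this

end SBF
end

section
open Polynomial
open scoped IsMulCommutative

namespace SBF

theorem finite_comm {D : Type*} [DivisionRing D] (p : ℕ) [Fact p.Prime] [CharP D p]
    (M : Submonoid D) (hM : (M : Set D).Finite) {u v : D} (hu : u ∈ M) (hv : v ∈ M) :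
    u * v = v * u := by
  let _ : Algebra (ZMod p) D := ZMod.algebra D p
  let A := Algebra.adjoin (ZMod p) (M : Set D)
  have : Module.Finite (ZMod p) A := by
    have h1 : Subalgebra.toSubmodule A = Submodule.span (ZMod p) (M : Set D) := by
      rw [Algebra.adjoin_eq_span, Submonoid.closure_eq]
    have h2 : (Subalgebra.toSubmodule A).FG := by
      rw [h1]; exact Submodule.fg_span hM
    exact Module.Finite.iff_fg.mpr h2
  have : Finite A := Module.finite_of_finite (ZMod p)
  have hf := Finite.isDomain_to_isField A
  have := hf.mul_comm ⟨u, Algebra.subset_adjoin hu⟩ ⟨v, Algebra.subset_adjoin hv⟩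
  exact congrArg Subtype.val this

theorem sym_poly {K : Type*} [CommRing K] [IsDomain K] (τ : K →+* K) (a : K) (N : ℕ) (hN : 0 < N)
    (h : τ^[N] a = a) : ∃ q : K[X], q.Monic ∧ q.map τ = q ∧ q.eval a = 0 := by
  refine ⟨∏ i ∈ Finset.range N, (X - C (τ^[i] a)), monic_prod_of_monic _ _ fun i _ => monic_X_sub_C _, ?_, ?_⟩
  · rw [Polynomial.map_prod]
    have h0 : (X - C a : K[X]) ≠ 0 := X_sub_C_ne_zero a
    apply mul_right_cancel₀ h0
    have h1 := Finset.prod_range_succ (fun i => (X - C (τ^[i] a) : K[X])) N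
    have h2 := Finset.prod_range_succ' (fun i => (X - C (τ^[i] a) : K[X])) N
    rw [h] at h1
    rw [← h1, h2]
    congr 1
    refine Finset.prod_congr rfl fun i _ => ?_
    rw [Polynomial.map_sub, map_X, map_C, Function.iterate_succ_apply']
  · rw [eval_prod]
    apply Finset.prod_eq_zero (i := 0) (by simpa using hN)
    simp

theorem pow_eq {K : Type*} [CommRing K] (q : K[X]) (hq : q.Monic) (a : K) (h0 : q.eval a = 0)
    (Z : Subring K) [Finite Z] (hZ : ∀ i, q.coeff i ∈ Z) : ∃ i j, i < j ∧ a ^ i = a ^ j := by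
  have hIntegral : IsIntegral Z a := by
    have hc : (↑q.coeffs : Set K) ⊆ Z := by
      intro c hc
      obtain ⟨n, _, rfl⟩ := mem_coeffs_iff.mp hc
      exact hZ n
    refine ⟨q.toSubring Z hc, (monic_toSubring q Z hc).mpr hq, ?_⟩
    have : (q.toSubring Z hc).map (algebraMap Z K) = q := by
      ext i; rw [coeff_map]; exact coeff_toSubring' q Z hc
    rw [← eval_map, this, h0]
  have hfg := hIntegral.fg_adjoin_singleton
  have : Module.Finite Z (Algebra.adjoin Z {a}) := Module.Finite.iff_fg.mpr hfg
  have : Finite (Algebra.adjoin Z {a}) := Module.finite_of_finite Z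
  obtain ⟨i, j, hij, h⟩ := Finite.exists_ne_map_eq_of_infinite
    (fun i : ℕ => (⟨a, Algebra.self_mem_adjoin_singleton Z a⟩ : Algebra.adjoin Z {a}) ^ i)
  have h' : a ^ i = a ^ j := by simpa using congrArg Subtype.val h
  rcases lt_or_gt_of_ne hij with h1 | h1
  · exact ⟨i, j, h1, h'⟩
  · exact ⟨j, i, h1, h'.symm⟩

theorem unit_fin {Γ : Type*} [Group Γ] {a : Γ} {i j : ℕ} (hij : i < j) (h : a ^ i = a ^ j) :
    ∃ m, 0 < m ∧ a ^ m = 1 := by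
  refine ⟨j - i, by omega, ?_⟩
  have : j = i + (j - i) := by omega
  rw [this, pow_add] at h
  exact (mul_eq_left.mp h.symm)

theorem powers_fin {D : Type*} [DivisionRing D] {x : Dˣ} {k : ℕ} (hk : 0 < k)
    (h : x ^ k = 1) : (Submonoid.powers (x : D) : Set D).Finite := by
  have h' : (x : D) ^ k = 1 := by
    rw [← Units.val_pow_eq_pow_val, h, Units.val_one]
  refine ((Set.finite_lt_nat k).image (fun i => (x : D) ^ i)).subset ?_
  rintro _ ⟨i, rfl⟩
  refine ⟨i % k, Nat.mod_lt _ hk, ?_⟩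
  have e : (x : D) ^ i = (x : D) ^ (i % k + k * (i / k)) := by rw [Nat.mod_add_div]
  change (x : D) ^ (i % k) = (x : D) ^ i
  rw [e, pow_add, pow_mul, h', one_pow, mul_one]

set_option maxHeartbeats 1600000 in
theorem abelian_pair {D : Type*} [DivisionRing D] (p : ℕ) [Fact p.Prime] [CharP D p]
    {n : ℕ} {G : Subgroup Dˣ} (hG : Ch n G)
    (hab : ∀ g ∈ G, ∀ h ∈ G, g * h = h * g) {a x : Dˣ} (ha : a ∈ G)
    (hxG : ∀ g ∈ G, x * g * x⁻¹ ∈ G) (hxG' : ∀ g ∈ G, x⁻¹ * g * x ∈ G) : a * x = x * a := by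
  by_contra hax
  have hx0 : (x : D) ≠ 0 := x.ne_zero
  obtain ⟨N, hN, hNa⟩ := exists_pow_comm hG hab ha hxG hxG' hax
  have hZ := finite_center hG hab ha hax
  set B := cent {(a : D), (x : D)} with hB
  have haL : (a : D) ∈ cent (B : Set D) := fun g hg => (hg _ (by simp)).symm
  have hxL : (x : D) ∈ cent (B : Set D) := fun g hg => (hg _ (by simp)).symm
  -- `x` has finite order
  have hxfin : ∃ m, 0 < m ∧ x ^ m = 1 := by
    have hmem : ∀ i : ℕ, (x : D) ^ (N * i) ∈ {z : D | z ∈ B ∧ z ∈ cent (B : Set D)} := by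
      intro i
      refine ⟨?_, pow_mem hxL _⟩
      have hcom : (a : D) * x ^ N = x ^ N * a := by
        exact_mod_cast congrArg Units.val hNa.symm
      rintro g (rfl | rfl)
      · rw [pow_mul]; exact (Commute.pow_right hcom i).eq
      · exact (Commute.pow_right (Commute.refl (x : D)) _).eq
    have := hZ.to_subtype
    obtain ⟨i, j, hij, h⟩ := Finite.exists_ne_map_eq_of_infinite
      (fun i : ℕ => (⟨_, hmem i⟩ : {z : D | z ∈ B ∧ z ∈ cent (B : Set D)}))
    have h' : (x : D) ^ (N * i) = x ^ (N * j) := congrArg Subtype.val h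
    have h'' : x ^ (N * i) = x ^ (N * j) := Units.ext (by simpa using h')
    rcases lt_or_gt_of_ne hij with h1 | h1
    · exact unit_fin (Nat.mul_lt_mul_of_pos_left h1 hN) h''
    · exact unit_fin (Nat.mul_lt_mul_of_pos_left h1 hN) h''.symm
  let S : Set D := {d | ∃ g ∈ G, (g : D) = d ∧ d ∈ cent (B : Set D)}
  have hScomm : ∀ u ∈ S, ∀ v ∈ S, u * v = v * u := by
    rintro _ ⟨g, hg, rfl, _⟩ _ ⟨h, hh, rfl, _⟩
    exact congrArg Units.val (hab g hg h hh)
  have hSone : (1 : D) ∈ S := ⟨1, one_mem _, rfl, one_mem _⟩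
  have hSmul : ∀ u ∈ S, ∀ v ∈ S, u * v ∈ S := by
    rintro _ ⟨g, hg, rfl, h1⟩ _ ⟨h, hh, rfl, h2⟩
    exact ⟨g * h, mul_mem hg hh, rfl, mul_mem h1 h2⟩
  let K := Subring.closure S
  have : IsMulCommutative K := Subring.isMulCommutative_closure hScomm
  have hKL : ∀ u ∈ K, u ∈ cent (B : Set D) := by
    have : K ≤ (cent (B : Set D)).toSubring := by
      refine Subring.closure_le.mpr ?_
      rintro u ⟨_, _, _, h⟩
      exact h
    exact this
  have hSK : S ⊆ K := Subring.subset_closure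
  have hxS : ∀ u ∈ S, (x : D) * u * (x : D)⁻¹ ∈ S := by
    rintro _ ⟨g, hg, rfl, h⟩
    exact ⟨_, hxG g hg, by simp, mul_mem (mul_mem hxL h) (inv_mem hxL)⟩
  have hxK : ∀ u ∈ K, cj (x : D) hx0 u ∈ K := by
    have : K ≤ K.comap (cj (x : D) hx0) := by
      refine Subring.closure_le.mpr ?_
      intro u hu
      exact hSK (hxS u hu)
    exact this
  have haS : (a : D) ∈ S := ⟨a, ha, rfl, haL⟩
  have : IsDomain K := inferInstance
  let τ : K →+* K := (cj (x : D) hx0).restrict K K hxK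
  let a' : K := ⟨a, hSK haS⟩
  have hiter : ∀ (i : ℕ) (u : K), ((τ^[i] u : K) : D) = (x : D) ^ i * u * (x : D)⁻¹ ^ i := by
    intro i
    induction i with
    | zero => intro u; simp
    | succ i ih =>
      intro u
      rw [Function.iterate_succ_apply']
      have e : ((τ (τ^[i] u) : K) : D) = x * ((τ^[i] u : K) : D) * (x : D)⁻¹ := rfl
      rw [e, ih, pow_succ' (x : D), pow_succ (x : D)⁻¹]
      simp only [mul_assoc]
  have hxN : ∀ i, (x : D) ^ i ≠ 0 := fun i => pow_ne_zero _ hx0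
  have haN : τ^[N] a' = a' := by
    apply Subtype.ext
    rw [hiter]
    have hcom : (x : D) ^ N * a = a * x ^ N := by exact_mod_cast congrArg Units.val hNa
    change (x : D) ^ N * a * _ = a
    rw [hcom, inv_pow, mul_assoc, mul_inv_cancel₀ (hxN N), mul_one]
  obtain ⟨q, hqm, hqτ, hqa⟩ := sym_poly τ a' N hN haN
  let Z : Subring K := (B.toSubring ⊓ (cent (B : Set D)).toSubring).comap K.subtype
  have hZfin : Finite Z := by
    have hsub : (Z : Set K).Finite := by
      refine Set.Finite.preimage (f := fun k : K => (k : D)) Subtype.val_injective.injOn hZ |>.subset ?_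
      intro z hz
      exact hz
    exact hsub.to_subtype
  have hcoef : ∀ i, q.coeff i ∈ Z := by
    intro i
    have h1 : τ (q.coeff i) = q.coeff i := by
      conv_rhs => rw [← hqτ]
      rw [coeff_map]
    generalize q.coeff i = u at h1
    have h2 : (x : D) * u * (x : D)⁻¹ = u := congrArg Subtype.val h1
    have h3 : (x : D) * u = u * x := by rwa [mul_inv_eq_iff_eq_mul₀ hx0] at h2
    have h4 : (a : D) * u = u * a := congrArg Subtype.val (mul_comm a' u)
    refine ⟨?_, ?_⟩
    · rintro g (rfl | rfl)
      · exact h4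
      · exact h3
    · exact hKL _ u.2
  obtain ⟨i, j, hij, hpow⟩ := pow_eq q hqm a' hqa Z hcoef
  have hpow' : a ^ i = a ^ j := Units.ext (by simpa [a'] using congrArg Subtype.val hpow)
  obtain ⟨m, hm, ham⟩ := unit_fin hij hpow'
  obtain ⟨k, hk, hxk⟩ := hxfin
  -- finite monoid
  let A : Set D := {d | d ∈ S ∧ d ^ m = 1}
  have hAfin : A.Finite := by
    have h1 : {r : K | r ^ m = 1}.Finite := by
      classical
      refine (Polynomial.nthRoots m (1 : K)).toFinset.finite_toSet.subset ?_
      intro r hr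
      simpa [Polynomial.mem_nthRoots hm] using hr
    refine (h1.image Subtype.val).subset ?_
    rintro d ⟨hd, hdm⟩
    exact ⟨⟨d, hSK hd⟩, Subtype.ext (by simpa using hdm), rfl⟩
  have hAx : ∀ i : ℕ, ∀ u ∈ A, (x : D) ^ i * u * (x : D)⁻¹ ^ i ∈ A := by
    intro i
    induction i with
    | zero => intro u hu; simpa using hu
    | succ i ih =>
      intro u hu
      obtain ⟨h1, h2⟩ := ih u hu
      have e : (x : D) ^ (i + 1) * u * (x : D)⁻¹ ^ (i + 1)
          = x * ((x : D) ^ i * u * (x : D)⁻¹ ^ i) * (x : D)⁻¹ := by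
        rw [pow_succ' (x : D), pow_succ (x : D)⁻¹]; simp only [mul_assoc]
      rw [e]
      refine ⟨hxS _ h1, ?_⟩
      rw [← cj_apply _ hx0, ← map_pow, h2, map_one]
  let M : Submonoid D :=
    { carrier := Set.image2 (fun u y => u * y) A (Submonoid.powers (x : D) : Set D)
      one_mem' := ⟨1, ⟨hSone, one_pow _⟩, 1, one_mem _, mul_one _⟩
      mul_mem' := by
        rintro _ _ ⟨u, hu, _, ⟨i, rfl⟩, rfl⟩ ⟨v, hv, _, ⟨j, rfl⟩, rfl⟩
        obtain ⟨h1, h2⟩ := hAx i v hv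
        refine ⟨u * ((x : D) ^ i * v * (x : D)⁻¹ ^ i), ⟨hSmul _ hu.1 _ h1, ?_⟩,
          (x : D) ^ (i + j), ⟨_, rfl⟩, ?_⟩
        · rw [(show Commute _ _ from hScomm _ hu.1 _ h1).mul_pow, hu.2, h2, one_mul]
        · simp only
          rw [pow_add]
          simp only [mul_assoc]
          rw [← mul_assoc ((x : D)⁻¹ ^ i), inv_pow, inv_mul_cancel₀ (hxN i), one_mul] }
  have hpfin : (Submonoid.powers (x : D) : Set D).Finite := by
    exact powers_fin hk hxk
  have hMfin : (M : Set D).Finite := hAfin.image2 _ hpfin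
  have haM : (a : D) ∈ M :=
    ⟨a, ⟨haS, by rw [← Units.val_pow_eq_pow_val, ham, Units.val_one]⟩, 1, one_mem _, mul_one _⟩
  have hxM : (x : D) ∈ M := ⟨1, ⟨hSone, one_pow _⟩, x, Submonoid.mem_powers _, one_mul _⟩
  exact hax (Units.ext (finite_comm p M hMfin haM hxM))

/-- center infinite in characteristic zero -/
theorem infinite_of_charZero (D : Type*) [DivisionRing D] [CharZero D] :
    {t : D | ∀ z, t * z = z * t}.Infinite := by
  refine (Set.infinite_range_of_injective (Nat.cast_injective (R := D))).mono ?_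
  rintro _ ⟨n, rfl⟩ z
  exact (Nat.cast_commute n z).eq

theorem abelian_central {D : Type*} [DivisionRing D] (n : ℕ) : ∀ G : Subgroup Dˣ, Ch n G →
    (∀ g ∈ G, ∀ h ∈ G, g * h = h * g) → ∀ a ∈ G, ∀ x : Dˣ, a * x = x * a := by
  rcases CharP.exists' D with h0 | ⟨p, hp, hcp⟩
  · intro G hG hab a ha x
    exact Units.ext (central_of_infinite (infinite_of_charZero D) hG hab ha x)
  induction n with
  | zero =>
    intro G hG hab a ha x
    cases hG
    exact hab a ha x trivial
  | succ n ih =>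
    intro G hG hab a ha x
    have hG' := hG
    cases hG with
    | @step _ _ K hle hn hK =>
    have hcen : ∀ a ∈ G, ∀ x ∈ K, a * x = x * a := by
      intro a ha x hx
      refine abelian_pair p hG' hab ha (hn x hx) ?_
      intro g hg
      simpa using hn x⁻¹ (inv_mem hx) g hg
    cases hK with
    | top => exact hcen a ha x trivial
    | @step m _ K2 hle2 hn2 hK2 =>
      let Z : Subgroup Dˣ := K ⊓ Subgroup.centralizer (K : Set Dˣ)
      have hZc : ∀ z ∈ Z, ∀ k ∈ K, z * k = k * z := fun z hz k hk =>
        (Subgroup.mem_centralizer_iff.mp hz.2 k hk).symm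
      refine ih Z (Ch.step (inf_le_left.trans hle2) ?_ hK2) (fun g hg h hh => hZc g hg h hh.1) a
        ⟨hle ha, Subgroup.mem_centralizer_iff.mpr fun k hk => (hcen a ha k hk).symm⟩ x
      intro k hk z hz
      refine ⟨hn2 k hk z hz.1, Subgroup.mem_centralizer_iff.mpr ?_⟩
      intro h hh
      have h1 := hZc z hz (k⁻¹ * h * k) (by simpa using hn2 k⁻¹ (inv_mem hk) h hh)
      have h2 := congrArg (fun u => k * u * k⁻¹) h1
      simp only [mul_assoc, mul_inv_cancel_left, mul_inv_cancel, mul_one] at h2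
      simp only [mul_assoc]
      exact h2.symm

end SBF
end

section
open Polynomial
open scoped commutatorElement
namespace SBF

theorem Ch.of_chain {Γ : Type*} [Group Γ] : ∀ (k : ℕ) (s : ℕ → Subgroup Γ), s k = ⊤ →
    (∀ i < k, s i ≤ s (i + 1) ∧ ((s i).subgroupOf (s (i + 1))).Normal) → Ch k (s 0) := by
  intro k
  induction k with
  | zero => intro s h _; rw [h]; exact Ch.top
  | succ k ih =>
    intro s h hs
    have h1 : Ch k (s 1) := ih (fun i => s (i + 1)) h (fun i hi => hs (i + 1) (by omega))
    obtain ⟨h2, h3⟩ := hs 0 (by omega)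
    refine Ch.step h2 ?_ h1
    intro x hx y hy
    have := h3.conj_mem ⟨y, h2 hy⟩ (Subgroup.mem_subgroupOf.mpr hy) ⟨x, hx⟩
    exact Subgroup.mem_subgroupOf.mp this

theorem Ch.comm {Γ : Type*} [Group Γ] {n : ℕ} {G : Subgroup Γ} (hG : Ch n G) :
    Ch (n + 1) ⁅G, G⁆ := by
  refine Ch.step (Subgroup.commutator_le.mpr fun a ha b hb => ?_) ?_ hG
  · rw [commutatorElement_def]
    exact mul_mem (mul_mem (mul_mem ha hb) (inv_mem ha)) (inv_mem hb)
  · intro k hk h hh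
    have : ⁅G, G⁆ ≤ ⁅G, G⁆.comap (MulAut.conj k).toMonoidHom := by
      refine Subgroup.commutator_le.mpr fun a ha b hb => ?_
      rw [Subgroup.mem_comap, map_commutatorElement]
      refine Subgroup.commutator_mem_commutator ?_ ?_
      · simpa using mul_mem (mul_mem hk ha) (inv_mem hk)
      · simpa using mul_mem (mul_mem hk hb) (inv_mem hk)
    simpa using this hh

theorem class2_central {D : Type*} [DivisionRing D] {n : ℕ} {G : Subgroup Dˣ} (hG : Ch n G)
    (hc : ⁅G, G⁆ ≤ Subgroup.center Dˣ) : G ≤ Subgroup.center Dˣ := by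
  intro a ha
  let A : Subgroup Dˣ := Subgroup.closure ({a} ∪ (G ⊓ Subgroup.center Dˣ : Subgroup Dˣ))
  have hAG : A ≤ G := by
    refine (Subgroup.closure_le _).mpr ?_
    rintro y (rfl | hy)
    · exact ha
    · exact hy.1
  have haA : a ∈ A := Subgroup.subset_closure (Or.inl rfl)
  have hA : Ch (n + 1) A := by
    refine Ch.step hAG ?_ hG
    intro k hk h hh
    have : A ≤ A.comap (MulAut.conj k).toMonoidHom := by
      refine (Subgroup.closure_le _).mpr ?_
      rintro y (rfl | hy)
      · change k * y * k⁻¹ ∈ A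
        have e : k * y * k⁻¹ = ⁅k, y⁆ * y := by
          rw [commutatorElement_def]; group
        rw [e]
        refine mul_mem (Subgroup.subset_closure (Or.inr ⟨?_, ?_⟩)) haA
        · change _ ∈ G; rw [commutatorElement_def]
          exact mul_mem (mul_mem (mul_mem hk ha) (inv_mem hk)) (inv_mem ha)
        · exact hc (Subgroup.commutator_mem_commutator hk ha)
      · change k * y * k⁻¹ ∈ A
        rw [Subgroup.mem_center_iff.mp hy.2 k, mul_inv_cancel_right]
        exact Subgroup.subset_closure (Or.inr hy)
    exact this hh
  have hcomm : ∀ g ∈ A, ∀ h ∈ A, g * h = h * g := by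
    have h1 : ∀ g ∈ A, a * g = g * a := by
      have : A ≤ Subgroup.centralizer {a} := by
        refine (Subgroup.closure_le _).mpr ?_
        rintro y (rfl | hy)
        · exact Subgroup.mem_centralizer_iff.mpr (by rintro _ rfl; rfl)
        · exact Subgroup.mem_centralizer_iff.mpr fun g _ => Subgroup.mem_center_iff.mp hy.2 g
      exact fun g hg => Subgroup.mem_centralizer_iff.mp (this hg) a rfl
    intro g hg
    have : A ≤ Subgroup.centralizer {g} := by
      refine (Subgroup.closure_le _).mpr ?_
      rintro y (rfl | hy)
      · exact Subgroup.mem_centralizer_iff.mpr (by rintro _ rfl; exact (h1 _ hg).symm)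
      · exact Subgroup.mem_centralizer_iff.mpr fun g _ => Subgroup.mem_center_iff.mp hy.2 g
    exact fun h hh => Subgroup.mem_centralizer_iff.mp (this hh) g rfl
  exact Subgroup.mem_center_iff.mpr fun x => (abelian_central (n + 1) A hA hcomm a haA x).symm

theorem map_der {Γ : Type*} [Group Γ] (G : Subgroup Γ) (d : ℕ) :
    (derivedSeries G (d + 1)).map G.subtype =
      ⁅(derivedSeries G d).map G.subtype, (derivedSeries G d).map G.subtype⁆ := by
  rw [derivedSeries_succ, Subgroup.map_commutator]

theorem solvable_central {D : Type*} [DivisionRing D] {n : ℕ} {G : Subgroup Dˣ} (hG : Ch n G)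
    (hs : IsSolvable G) : G ≤ Subgroup.center Dˣ := by
  obtain ⟨d, hd⟩ := hs
  have hch : ∀ i, ∃ m, Ch m ((derivedSeries G i).map G.subtype) := by
    intro i
    induction i with
    | zero => exact ⟨n, by simpa [← MonoidHom.range_eq_map] using hG⟩
    | succ i ih => obtain ⟨m, hm⟩ := ih; exact ⟨m + 1, by rw [map_der]; exact hm.comm⟩
  have key : ∀ i ≤ d, (derivedSeries G (d - i)).map G.subtype ≤ Subgroup.center Dˣ := by
    intro i
    induction i with
    | zero => intro _; simp [hd]
    | succ i ih =>
      intro hi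
      obtain ⟨m, hm⟩ := hch (d - (i + 1))
      refine class2_central hm ?_
      rw [← map_der, show d - (i + 1) + 1 = d - i by omega]
      exact ih (by omega)
  have := key d le_rfl
  simpa [← MonoidHom.range_eq_map] using this

theorem comm_finite {Γ : Type*} [Group Γ] {G N : Subgroup Γ} 
    (hc : N ≤ Subgroup.center Γ) (hf : Finite (G ⧸ N.subgroupOf G)) :
    Finite (⁅G, G⁆ : Subgroup Γ) := by
  have h1 : ∀ g h : G, ∀ y : Γ, (g : G ⧸ N.subgroupOf G) = h → 
      ⁅(g : Γ), y⁆ = ⁅(h : Γ), y⁆ ∧ ⁅y, (g : Γ)⁆ = ⁅y, (h : Γ)⁆ := by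
    intro g h y e
    have h2 : (g : Γ)⁻¹ * h ∈ N := by
      have := QuotientGroup.eq.mp e
      simpa [Subgroup.mem_subgroupOf] using this
    obtain ⟨z, hz⟩ : ∃ z, (g : Γ)⁻¹ * h = z := ⟨_, rfl⟩
    rw [hz] at h2
    have e2 : (h : Γ) = g * z := by rw [← hz]; group
    have hzc := Subgroup.mem_center_iff.mp (hc h2)
    have e3 : ⁅(g : Γ) * z, y⁆ = ⁅(g : Γ), y⁆ := by
      simp only [commutatorElement_def, mul_inv_rev]
      rw [mul_assoc (g : Γ) z y, ← hzc y]; group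
    refine ⟨by rw [e2, e3], ?_⟩
    rw [← commutatorElement_inv, ← commutatorElement_inv (h : Γ), e2, e3]
  have hfs : (commutatorSet G).Finite := by
    refine (Set.finite_range (fun q : (G ⧸ N.subgroupOf G) × (G ⧸ N.subgroupOf G) =>
      ⁅q.1.out, q.2.out⁆)).subset ?_
    rintro _ ⟨a, b, rfl⟩
    refine ⟨(a, b), Subtype.ext ?_⟩
    have ha : ((Quotient.out (a : G ⧸ N.subgroupOf G) : G) : G ⧸ N.subgroupOf G) = a :=
      QuotientGroup.out_eq' _
    have hb : ((Quotient.out (b : G ⧸ N.subgroupOf G) : G) : G ⧸ N.subgroupOf G) = b :=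
      QuotientGroup.out_eq' _
    exact ((h1 _ _ _ ha).1).trans ((h1 _ _ _ hb).2)
  have : Finite (commutatorSet G) := hfs.to_subtype
  have hF : Finite (commutator G) := inferInstance
  have e : ⁅G, G⁆ = (commutator G).map G.subtype := by
    rw [commutator_def, Subgroup.map_commutator, ← MonoidHom.range_eq_map, Subgroup.range_subtype]
  rw [e]
  exact (Set.Finite.image (G.subtype) (Set.toFinite (commutator G : Set G))).to_subtype

theorem finite_central {D : Type*} [DivisionRing D] {n : ℕ} {G : Subgroup Dˣ} (hG : Ch n G)
    [hf : Finite G] : G ≤ Subgroup.center Dˣ := by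
  intro a ha
  refine Subgroup.mem_center_iff.mpr fun x => ?_
  rcases CharP.exists' D with h0 | ⟨p, hp, hcp⟩
  · exact Units.ext (central_of_finite_charZero hG ha (x : D)).symm
  · refine (abelian_central n G hG ?_ a ha x).symm
    intro g hg h hh
    refine Units.ext (finite_comm p (G.toSubmonoid.map (Units.coeHom D)) ?_
      ⟨g, hg, rfl⟩ ⟨h, hh, rfl⟩)
    exact Set.Finite.image _ (Set.toFinite (G : Set Dˣ))

theorem final {D : Type*} [DivisionRing D] {n : ℕ} {G N : Subgroup Dˣ} (hG : Ch n G)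
    (hle : N ≤ G) (hn : (N.subgroupOf G).Normal) (hs : IsSolvable N)
    (hf : Finite (G ⧸ N.subgroupOf G)) : G ≤ Subgroup.center Dˣ := by
  have hN : Ch (n + 1) N := by
    refine Ch.step hle ?_ hG
    intro k hk h hh
    have := hn.conj_mem ⟨h, hle hh⟩ (Subgroup.mem_subgroupOf.mpr hh) ⟨k, hk⟩
    exact Subgroup.mem_subgroupOf.mp this
  have hNc := solvable_central hN hs
  have := comm_finite hNc hf
  exact class2_central hG (finite_central hG.comm)

end SBF
end

/-- A solvable-by-finite subnormal subgroup of the multiplicative group of a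
division ring is central. -/
theorem subnormal_solvableByFinite_subset_center {D : Type*} [DivisionRing D]
    (G : Subgroup Dˣ) (hG : IsSubnormal G)
    (hsbf : ∃ N : Subgroup Dˣ, N ≤ G ∧ (N.subgroupOf G).Normal ∧ IsSolvable ↥N ∧
      Finite (↥G ⧸ N.subgroupOf G)) :
    ∀ x ∈ G, (x : D) ∈ Subring.center D := by
  obtain ⟨k, s, h0, hk, hs⟩ := hG
  obtain ⟨N, hle, hn, hsol, hf⟩ := hsbf
  have hch := SBF.Ch.of_chain k s hk hs
  rw [h0] at hch
  have hc := SBF.final hch hle hn hsol hf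
  intro x hx
  refine Subring.mem_center_iff.mpr fun z => ?_
  by_cases hz : z = 0
  · simp [hz]
  · exact congrArg Units.val (Subgroup.mem_center_iff.mp (hc hx) (Units.mk0 z hz))
end

section
/- Let D be a division ring with center F, and let G be a subnormal subgroup of D*. If G is a finite group, then G is contained in F. -/
open Polynomial

theorem ore_poly {D : Type*} [DivisionRing D] (A B : D[X]) (hB : B ≠ 0) :
    ∃ E C : D[X], E ≠ 0 ∧ E * A = C * B := by
  classical
  set m := max A.natDegree B.natDegree with hm
  have hdeg : ∀ P : D[X], P.natDegree ≤ m → ∀ u ∈ degreeLT D (m + 1),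
      u * P ∈ degreeLT D (m + 1 + m) := by
    intro P hP u hu
    rw [mem_degreeLT] at hu ⊢
    by_cases h0 : u * P = 0
    · rw [h0, degree_zero]; exact WithBot.bot_lt_coe _
    · have hu0 : u ≠ 0 := left_ne_zero_of_mul h0
      rw [← natDegree_lt_iff_degree_lt hu0] at hu
      rw [← natDegree_lt_iff_degree_lt h0]
      have := natDegree_mul_le (p := u) (q := P)
      omega
  let f : (degreeLT D (m + 1) × degreeLT D (m + 1)) →ₗ[D] degreeLT D (m + 1 + m) :=
    { toFun := fun p => ⟨p.1.1 * A - p.2.1 * B,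
        Submodule.sub_mem _ (hdeg A (le_max_left _ _) _ p.1.2) (hdeg B (le_max_right _ _) _ p.2.2)⟩
      map_add' := by
        intro p q
        ext1
        simp only [Prod.fst_add, Prod.snd_add, Submodule.coe_add, add_mul]
        abel
      map_smul' := by
        intro c p
        ext1
        simp only [Prod.smul_fst, Prod.smul_snd, Submodule.coe_smul, RingHom.id_apply, smul_sub,
          smul_eq_C_mul, mul_assoc] }
  have : ∀ n, FiniteDimensional D (degreeLT D n) := fun n =>
    Module.Finite.equiv (degreeLTEquiv D n).symm
  have hfr : ∀ n, Module.finrank D (degreeLT D n) = n := fun n => by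
    rw [(degreeLTEquiv D n).finrank_eq]; simp
  have hk : LinearMap.ker f ≠ ⊥ := by
    apply LinearMap.ker_ne_bot_of_finrank_lt
    rw [Module.finrank_prod, hfr, hfr]
    omega
  obtain ⟨p, hp, hp0⟩ := Submodule.exists_mem_ne_zero_of_ne_bot hk
  have hrel : p.1.1 * A = p.2.1 * B := by
    have := congrArg Subtype.val (LinearMap.mem_ker.1 hp)
    exact sub_eq_zero.1 this
  refine ⟨p.1.1, p.2.1, ?_, hrel⟩
  intro h0
  rw [h0, zero_mul] at hrel
  have h1 := (mul_eq_zero.1 hrel.symm).resolve_right hB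
  exact hp0 (Prod.ext (Subtype.ext h0) (Subtype.ext h1))

/-- evaluation at a central element -/
noncomputable def cev {D : Type*} [DivisionRing D] (a : D) (ha : ∀ d : D, Commute d a) : D[X] →+* D :=
  eval₂RingHom' (RingHom.id D) a ha

theorem cev_C {D : Type*} [DivisionRing D] (a : D) (ha : ∀ d : D, Commute d a) (c : D) :
    cev a ha (C c) = c := by simp [cev, eval₂RingHom']

theorem cev_X {D : Type*} [DivisionRing D] (a : D) (ha : ∀ d : D, Commute d a) :
    cev a ha X = a := by simp [cev, eval₂RingHom']

theorem cev_roots {D : Type*} [DivisionRing D] (L : ℕ → D) (hL : Function.Injective L)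
    (hc : ∀ n d, Commute d (L n)) (N : ℕ) : ∀ (P : D[X]), P.natDegree ≤ N → ∀ S : Set ℕ, S.Infinite →
    (∀ n ∈ S, cev (L n) (hc n) P = 0) → P = 0 := by
  induction N with
  | zero =>
    intro P hP S hS h
    obtain ⟨n, hn⟩ := hS.nonempty
    have := h n hn
    rw [eq_C_of_natDegree_le_zero hP, cev_C] at this
    rw [eq_C_of_natDegree_le_zero hP, this, C_0]
  | succ N ih =>
    intro P hP S hS h
    obtain ⟨n, hn⟩ := hS.nonempty
    have hmod := modByMonic_add_div P (X - C (L n))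
    have hd : (P %ₘ (X - C (L n))).natDegree ≤ 0 := by
      have h1 := natDegree_modByMonic_lt P (monic_X_sub_C (L n)) (by
        intro h; have := congrArg natDegree h; simp at this)
      rw [natDegree_X_sub_C] at h1
      omega
    rw [eq_C_of_natDegree_le_zero hd] at hmod
    set r := (P %ₘ (X - C (L n))).coeff 0
    set Q := P /ₘ (X - C (L n)) with hQ
    have hr : r = 0 := by
      have := h n hn
      rw [← hmod] at this
      simpa [cev_C, cev_X] using this
    rw [hr, C_0, zero_add] at hmod
    have hQ0 : Q = 0 := by
      apply ih Q _ (S \ {n}) (hS.sdiff (Set.finite_singleton n))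
      · intro k hk
        have := h k hk.1
        rw [← hmod] at this
        simp only [map_mul, map_sub, cev_C, cev_X] at this
        refine (mul_eq_zero.1 this).resolve_left ?_
        exact fun h => hk.2 (hL (sub_eq_zero.1 h))
      · rw [hQ, natDegree_divByMonic _ (monic_X_sub_C _), natDegree_X_sub_C]
        omega
    rw [← hmod, hQ0, mul_zero]

def IsRat {D : Type*} [DivisionRing D] (L : ℕ → D)
    (hc : ∀ n d, Commute d (L n)) (f : ℕ → D) (s : PowerSeries D) : Prop :=
  ∃ A B : D[X], B ≠ 0 ∧ (∀ n, cev (L n) (hc n) B * f n = cev (L n) (hc n) A) ∧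
    (B : PowerSeries D) * s = A

theorem IsRat.mul {D : Type*} [DivisionRing D] {L : ℕ → D}
    {hc : ∀ n d, Commute d (L n)} {f g : ℕ → D} {s t : PowerSeries D}
    (hf : IsRat L hc f s) (hg : IsRat L hc g t) : IsRat L hc (fun n => f n * g n) (s * t) := by
  obtain ⟨A, B, hB, h1, h2⟩ := hf
  obtain ⟨A', B', hB', h1', h2'⟩ := hg
  obtain ⟨E, C, hE, hEC⟩ := ore_poly A B' hB'
  refine ⟨C * A', E * B, mul_ne_zero hE hB, fun n => ?_, ?_⟩
  · rw [map_mul, map_mul, ← h1', ← mul_assoc, ← mul_assoc, mul_assoc _ _ (f n), h1, ← map_mul,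
      hEC, map_mul]
  · rw [coe_mul, coe_mul, ← h2', ← mul_assoc, ← mul_assoc, mul_assoc _ _ s, h2, ← coe_mul,
      hEC, coe_mul]

theorem IsRat.inv {D : Type*} [DivisionRing D] {L : ℕ → D}
    {hc : ∀ n d, Commute d (L n)} {f : ℕ → D} {s t : PowerSeries D}
    (hf : IsRat L hc f s) (h0 : ∀ n, f n ≠ 0) (hst : s * t = 1) :
    IsRat L hc (fun n => (f n)⁻¹) t := by
  obtain ⟨A, B, hB, h1, h2⟩ := hf
  have hBA : (A : PowerSeries D) * t = B := by rw [← h2, mul_assoc, hst, mul_one]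
  refine ⟨B, A, ?_, fun n => ?_, hBA⟩
  · rintro rfl
    rw [coe_zero, zero_mul] at hBA
    exact hB (coe_eq_zero_iff.1 hBA.symm)
  · rw [← h1, mul_assoc, mul_inv_cancel₀ (h0 n), mul_one]

theorem IsRat.poly {D : Type*} [DivisionRing D] (L : ℕ → D)
    (hc : ∀ n d, Commute d (L n)) (P : D[X]) :
    IsRat L hc (fun n => cev (L n) (hc n) P) P :=
  ⟨P, 1, one_ne_zero, fun n => by simp, by simp⟩

theorem IsRat.const_of_finite {D : Type*} [DivisionRing D] {L : ℕ → D} (hL : Function.Injective L)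
    {hc : ∀ n d, Commute d (L n)} {f : ℕ → D} {s : PowerSeries D}
    (hf : IsRat L hc f s) (hfin : (Set.range f).Finite) : PowerSeries.coeff 1 s = 0 := by
  obtain ⟨A, B, hB, h1, h2⟩ := hf
  have := hfin.to_subtype
  obtain ⟨c, hcc⟩ := Finite.exists_infinite_fiber (Set.rangeFactorization f)
  have hS : {n | f n = c}.Infinite := by
    rw [← Set.infinite_coe_iff]
    convert hcc using 2
    ext n
    simp [Set.rangeFactorization, Subtype.ext_iff]
  have hAB : B * C (c : D) - A = 0 := by
    refine cev_roots L hL hc _ _ le_rfl _ hS fun n hn => ?_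
    rw [map_sub, map_mul, cev_C, ← h1, hn, sub_self]
  have h3 : (B : PowerSeries D) * (s - PowerSeries.C (c : D)) = 0 := by
    rw [mul_sub, h2, ← coe_C, ← coe_mul, sub_eq_zero.1 hAB, sub_self]
  have h4 := (mul_eq_zero.1 h3).resolve_left (fun h => hB (coe_eq_zero_iff.1 h))
  rw [sub_eq_zero.1 h4, PowerSeries.coeff_C]
  simp

theorem coeff_one_mul' {D : Type*} [DivisionRing D] (s t : PowerSeries D) :
    PowerSeries.coeff 1 (s * t) = PowerSeries.coeff 0 s * PowerSeries.coeff 1 t +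
      PowerSeries.coeff 1 s * PowerSeries.coeff 0 t := by
  rw [PowerSeries.coeff_mul]
  simp [Finset.Nat.antidiagonal_succ]

/-- `v ↦ x v x⁻¹ - v` -/
def dl {D : Type*} [DivisionRing D] (x v : D) : D := x * v * x⁻¹ - v

/-- `y ↦ x y x⁻¹ y⁻¹` -/
def cm {D : Type*} [DivisionRing D] (x y : D) : D := x * y * x⁻¹ * y⁻¹

theorem cm_ne_zero {D : Type*} [DivisionRing D] {x y : D} (hx : x ≠ 0) (hy : y ≠ 0) :
    cm x y ≠ 0 := by
  simp [cm, hx, hy]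

theorem cm_iter_ne_zero {D : Type*} [DivisionRing D] {x y : D} (hx : x ≠ 0) (hy : y ≠ 0) (k : ℕ) :
    (cm x)^[k] y ≠ 0 := by
  induction k with
  | zero => exact hy
  | succ k ih => rw [Function.iterate_succ_apply']; exact cm_ne_zero hx ih

theorem dl_dl {D : Type*} [DivisionRing D] {x v : D} {n : ℕ} (hn : (n : D) ≠ 0)
    (hxn : x ^ n = 1) (h : dl x (dl x v) = 0) : dl x v = 0 := by
  set u := dl x v with hu
  have h1 : x * u * x⁻¹ = u := sub_eq_zero.1 h
  have h2 : x * v * x⁻¹ = v + u := by rw [hu, dl]; abel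
  have key : ∀ m : ℕ, x ^ m * v * (x ^ m)⁻¹ = v + m * u := by
    intro m
    induction m with
    | zero => simp
    | succ m ih =>
      have : x ^ (m + 1) * v * (x ^ (m + 1))⁻¹ = x * (x ^ m * v * (x ^ m)⁻¹) * x⁻¹ := by
        rw [pow_succ' x m, mul_inv_rev]; simp only [mul_assoc]
      rw [this, ih, mul_add, add_mul, h2, ← mul_assoc, ← Nat.cast_comm, mul_assoc (m : D),
        mul_assoc (m : D), h1]
      push_cast
      rw [add_mul, one_mul]; abel
  have h3 := key n
  rw [hxn, inv_one, mul_one, one_mul] at h3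
  have h4 : (n : D) * u = 0 := by
    have := h3.symm
    rwa [add_eq_left] at this
  exact (mul_eq_zero.1 h4).resolve_left hn

theorem dl_iter {D : Type*} [DivisionRing D] {x v : D} {n : ℕ} (hn : (n : D) ≠ 0)
    (hxn : x ^ n = 1) (hv : dl x v ≠ 0) (k : ℕ) : (dl x)^[k + 1] v ≠ 0 := by
  induction k with
  | zero => exact hv
  | succ k ih =>
    intro h
    apply ih
    rw [Function.iterate_succ_apply', Function.iterate_succ_apply'] at h
    rw [Function.iterate_succ_apply']
    exact dl_dl hn hxn h

theorem key_infinite {D : Type*} [DivisionRing D] (L : ℕ → D) (hL : Function.Injective L)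
    (hc : ∀ n d, Commute d (L n)) {x z : D} (hx : x ≠ 0) {n : ℕ} (hn : (n : D) ≠ 0)
    (hxn : x ^ n = 1) (hxz : x * z ≠ z * x) :
    (∀ i, 1 + z * L i ≠ 0) ∧
    ∀ k, ¬ (Set.range fun i => (cm x)^[k + 1] (1 + z * L i)).Finite := by
  have hne : ∀ i, 1 + z * L i ≠ 0 := by
    intro i h
    have hLi : L i ≠ 0 := by
      intro h0; rw [h0] at h; simp at h
    apply hxz
    apply mul_right_cancel₀ hLi
    have h1 : z * L i = -1 := by rw [eq_neg_iff_add_eq_zero, add_comm]; exact h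
    rw [mul_assoc, h1, mul_assoc, (hc i x).eq, ← mul_assoc, h1]; simp
  refine ⟨hne, fun k hfin => ?_⟩
  have main : ∀ j, ∃ s : PowerSeries D, IsRat L hc (fun i => (cm x)^[j] (1 + z * L i)) s ∧
      PowerSeries.coeff 0 s = 1 ∧ PowerSeries.coeff 1 s = (dl x)^[j] z := by
    intro j
    induction j with
    | zero =>
      refine ⟨((1 + C z * X : D[X]) : PowerSeries D), ?_, ?_, ?_⟩
      · convert IsRat.poly L hc (1 + C z * X) using 2
        simp [cev_C, cev_X]
      · rw [coeff_coe]; simp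
      · rw [coeff_coe]; simp [coeff_one]
    | succ j ih =>
      obtain ⟨s, hs, hs0, hs1⟩ := ih
      set t := PowerSeries.invOfUnit s 1 with ht
      have hst : s * t = 1 := PowerSeries.mul_invOfUnit s 1 (by simpa using hs0)
      have ht0 : PowerSeries.coeff 0 t = 1 := by
        have := congrArg (PowerSeries.coeff 0) hst
        simpa [hs0, PowerSeries.coeff_mul] using this
      have ht1 : PowerSeries.coeff 1 t = - (dl x)^[j] z := by
        have := congrArg (PowerSeries.coeff 1) hst
        rw [coeff_one_mul', hs0, hs1, ht0, PowerSeries.coeff_one] at this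
        simp at this
        exact eq_neg_of_add_eq_zero_left this
      have hCx : ∀ c : D, IsRat L hc (fun _ => c) (PowerSeries.C c) := fun c => by
        convert IsRat.poly L hc (C c) using 2
        · simp [cev_C]
        · simp
      refine ⟨PowerSeries.C x * s * PowerSeries.C x⁻¹ * t, ?_, ?_, ?_⟩
      · have := (((hCx x).mul hs).mul (hCx x⁻¹)).mul
          (hs.inv (fun i => cm_iter_ne_zero hx (hne i) j) hst)
        convert this using 2
        rw [Function.iterate_succ_apply']; rfl
      · simp only [PowerSeries.coeff_zero_eq_constantCoeff, map_mul,
          PowerSeries.constantCoeff_C] at hs0 ht0 ⊢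
        rw [hs0, ht0]; simp [hx]
      · rw [Function.iterate_succ_apply', dl]
        simp only [coeff_one_mul', ht1, hs1, ht0, hs0, PowerSeries.coeff_C,
          PowerSeries.coeff_zero_eq_constantCoeff, map_mul,
          PowerSeries.constantCoeff_C] 
        simp only [PowerSeries.coeff_zero_eq_constantCoeff] at hs0 
        simp [hs0, hx]
        abel
  obtain ⟨s, hs, -, hs1⟩ := main (k + 1)
  have := hs.const_of_finite hL hfin
  rw [hs1] at this
  refine dl_iter hn hxn ?_ k this
  intro h
  apply hxz
  exact (mul_inv_eq_iff_eq_mul₀ hx).1 (sub_eq_zero.1 h)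

theorem map_cm_iter {D₁ D : Type*} [DivisionRing D₁] [DivisionRing D] (φ : D₁ →+* D) (x y : D₁)
    (k : ℕ) : φ ((cm x)^[k] y) = (cm (φ x))^[k] (φ y) := by
  induction k with
  | zero => rfl
  | succ k ih =>
    rw [Function.iterate_succ_apply', Function.iterate_succ_apply', ← ih]
    simp [cm]

theorem chain_mem {D : Type*} [DivisionRing D] (G : Subgroup Dˣ) (hG : IsSubnormal G) :
    ∃ k, ∀ x ∈ G, ∀ y : Dˣ, ∃ g ∈ G, (cm (x : D))^[k + 1] (y : D) = (g : D) := by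
  obtain ⟨k, s, h0, hk, hs⟩ := hG
  refine ⟨k, fun x hx y => ?_⟩
  have hxs : ∀ j ≤ k, x ∈ s j := by
    intro j
    induction j with
    | zero => intro _; rw [h0]; exact hx
    | succ j ih => intro hj; exact (hs j (by omega)).1 (ih (by omega))
  have main : ∀ j ≤ k, ∃ g ∈ s (k - j), (cm (x : D))^[j] (y : D) = (g : D) := by
    intro j
    induction j with
    | zero => intro _; exact ⟨y, by simp [hk], rfl⟩
    | succ j ih =>
      intro hj
      obtain ⟨g, hg, hgj⟩ := ih (by omega)
      refine ⟨x * (g * x⁻¹ * g⁻¹), ?_, ?_⟩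
      · obtain ⟨hle, hnorm⟩ := hs (k - (j + 1)) (by omega)
        have he : k - (j + 1) + 1 = k - j := by omega
        rw [he] at hle hnorm
        have hx1 := hxs (k - (j + 1)) (by omega)
        refine mul_mem hx1 ?_
        have := hnorm.conj_mem ⟨x⁻¹, inv_mem (hle hx1)⟩
          (by rw [Subgroup.mem_subgroupOf]; exact inv_mem hx1) ⟨g, hg⟩
        rw [Subgroup.mem_subgroupOf] at this
        exact this
      · rw [Function.iterate_succ_apply', hgj, cm]
        push_cast
        simp only [mul_assoc]
  obtain ⟨g, hg, hgj⟩ := main k le_rfl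
  rw [Nat.sub_self, h0] at hg
  refine ⟨x * g * x⁻¹ * g⁻¹, ?_, ?_⟩
  · exact mul_mem (mul_mem (mul_mem hx hg) (inv_mem hx)) (inv_mem hg)
  · rw [Function.iterate_succ_apply', hgj, cm]
    push_cast
    rfl

theorem contra_of_hom {D₁ D : Type*} [DivisionRing D₁] [DivisionRing D] (φ : D₁ →+* D)
    (G : Subgroup Dˣ) (hG : IsSubnormal G) (hfin : Finite ↥G)
    (L : ℕ → D₁) (hL : Function.Injective L)
    (hc : ∀ n d, Commute d (L n)) {x z : D₁} (hx : x ≠ 0) {n : ℕ} (hn : (n : D₁) ≠ 0)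
    (hxn : x ^ n = 1) (hxz : x * z ≠ z * x) (g : Dˣ) (hg : g ∈ G) (hgx : φ x = (g : D)) : False := by
  obtain ⟨hne, hinf⟩ := key_infinite L hL hc hx hn hxn hxz
  obtain ⟨k, hk⟩ := chain_mem G hG
  apply hinf k
  have hF : (Set.range (fun g : G => ((g : Dˣ) : D))).Finite := Set.finite_range _
  refine Set.Finite.of_finite_image (f := φ) (hF.subset ?_) φ.injective.injOn
  rintro _ ⟨_, ⟨i, rfl⟩, rfl⟩
  obtain ⟨h, hh, e⟩ := hk g hg (Units.mk0 (φ (1 + z * L i)) ((map_ne_zero φ).2 (hne i)))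
  refine ⟨⟨h, hh⟩, ?_⟩
  show (h : D) = φ _
  rw [map_cm_iter, hgx, ← e, Units.val_mk0]

theorem eigen_exists {D : Type*} [DivisionRing D] {x z : D} (hx : x ≠ 0) {n : ℕ}
    (hn : (n : D) ≠ 0) (ho : orderOf x = n) (hxz : x * z ≠ z * x) :
    ∃ (i : ℕ) (v : D), v ≠ 0 ∧ v * x = x ^ i * v ∧ x ^ i ≠ x := by
  have hxn : x ^ n = 1 := by rw [← ho]; exact pow_orderOf_eq_one x
  by_contra! hcon
  let Z : ℕ → D := fun i => ∑ j ∈ Finset.range n, ((x ^ i)⁻¹) ^ j * z * x ^ j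
  have hZ : ∀ i, Z i * x = x ^ i * Z i := by
    intro i
    have hxi : x ^ i ≠ 0 := pow_ne_zero _ hx
    have h1 : (x ^ i)⁻¹ * (Z i * x) = Z i := by
      have h2 := Finset.sum_range_succ (fun j => ((x ^ i)⁻¹) ^ j * z * x ^ j) n
      rw [Finset.sum_range_succ'] at h2
      have h3 : ((x ^ i)⁻¹) ^ n * z * x ^ n = ((x ^ i)⁻¹) ^ 0 * z * x ^ 0 := by
        rw [inv_pow, ← pow_mul, mul_comm i n, pow_mul, hxn]; simp
      rw [h3] at h2
      have h4 := add_right_cancel h2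
      show (x ^ i)⁻¹ * ((∑ j ∈ Finset.range n, ((x ^ i)⁻¹) ^ j * z * x ^ j) * x) =
        ∑ j ∈ Finset.range n, ((x ^ i)⁻¹) ^ j * z * x ^ j
      refine Eq.trans ?_ h4
      rw [Finset.sum_mul, Finset.mul_sum]
      refine Finset.sum_congr rfl fun j _ => ?_
      rw [pow_succ' _ j, pow_succ x j]
      simp only [mul_assoc]
    rw [← h1]
    rw [mul_inv_cancel_left₀ hxi, h1]
  have hsum : ∑ i ∈ Finset.range n, Z i = n * z := by
    show ∑ i ∈ Finset.range n, ∑ j ∈ Finset.range n, ((x ^ i)⁻¹) ^ j * z * x ^ j = n * z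
    rw [Finset.sum_comm]
    have hn0 : 0 < n := Nat.pos_of_ne_zero (by rintro rfl; simp at hn)
    rw [Finset.sum_eq_single_of_mem 0 (Finset.mem_range.2 hn0)]
    · simp
    · intro j hj hj0
      simp only [mul_assoc]
      rw [← Finset.sum_mul]
      have hy : (x ^ j)⁻¹ ≠ 1 := by
        intro h
        rw [inv_eq_one] at h
        exact pow_ne_one_of_lt_orderOf hj0 (by rw [ho]; exact Finset.mem_range.1 hj) h
      have h1 := mul_geom_sum ((x ^ j)⁻¹) n
      rw [inv_pow, ← pow_mul, mul_comm j n, pow_mul, hxn] at h1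
      simp only [one_pow, inv_one, sub_self] at h1
      have h2 := (mul_eq_zero.1 h1).resolve_left (sub_ne_zero.2 hy)
      have h3 : ∑ i ∈ Finset.range n, ((x ^ i)⁻¹) ^ j = 0 := by
        rw [← h2]
        refine Finset.sum_congr rfl fun i _ => ?_
        rw [inv_pow, inv_pow, ← pow_mul, ← pow_mul, mul_comm]
      rw [h3, zero_mul]
  have hcomm : ∀ i, Z i * x = x * Z i := by
    intro i
    by_cases h : Z i = 0
    · rw [h]; simp
    · rw [hZ, hcon i _ h (hZ i)]
  have h5 : (n * z) * x = x * (n * z) := by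
    rw [← hsum, Finset.sum_mul, Finset.mul_sum]
    exact Finset.sum_congr rfl fun i _ => hcomm i
  apply hxz
  apply mul_left_cancel₀ hn
  rw [← mul_assoc (n : D) z x, h5, ← mul_assoc, ← mul_assoc, Nat.cast_comm]

theorem order_ne_zero {D : Type*} [DivisionRing D] (p : ℕ) [Fact p.Prime] [CharP D p] {x : D}
    (ho : 0 < orderOf x) : (orderOf x : D) ≠ 0 := by
  intro h
  rw [CharP.cast_eq_zero_iff D p] at h
  obtain ⟨m, hm⟩ := h
  have h1 : (x ^ m - 1) ^ p = 0 := by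
    rw [sub_pow_char_of_commute p (Commute.one_right _), one_pow, ← pow_mul, mul_comm, ← hm,
      pow_orderOf_eq_one, sub_self]
  have h2 := sub_eq_zero.1 (pow_eq_zero_iff (Nat.Prime.ne_zero Fact.out) |>.1 h1)
  have hm0 : m ≠ 0 := by rintro rfl; omega
  have hp := (Fact.out : p.Prime).two_le
  refine pow_ne_one_of_lt_orderOf hm0 ?_ h2
  rw [hm]
  nlinarith [Nat.pos_of_ne_zero hm0]

theorem pow_conj {D : Type*} [DivisionRing D] {x v : D} {i : ℕ} (h : v * x = x ^ i * v) (b : ℕ) :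
    ∀ c, v ^ b * x ^ c = x ^ (i ^ b * c) * v ^ b := by
  have h1 : ∀ c, v * x ^ c = x ^ (i * c) * v := by
    intro c
    induction c with
    | zero => simp
    | succ c ih => rw [pow_succ, ← mul_assoc, ih, mul_assoc, h, ← mul_assoc, ← pow_add, mul_add, mul_one]
  induction b with
  | zero => simp
  | succ b ih =>
    intro c
    rw [pow_succ, mul_assoc, h1, ← mul_assoc, ih, mul_assoc, pow_succ, mul_assoc]

theorem comm_of_finOrder {D : Type*} [DivisionRing D] (p : ℕ) [Fact p.Prime] [CharP D p] {x v : D}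
    {i : ℕ} (h : v * x = x ^ i * v) (hx : IsOfFinOrder x) (hv : IsOfFinOrder v) :
    x * v = v * x := by
  letI : Algebra (ZMod p) D := ZMod.algebra D p
  let M : Submonoid D :=
    { carrier := {d | ∃ a b : ℕ, d = x ^ a * v ^ b}
      one_mem' := ⟨0, 0, by simp⟩
      mul_mem' := by
        rintro _ _ ⟨a, b, rfl⟩ ⟨c, d, rfl⟩
        refine ⟨a + i ^ b * c, b + d, ?_⟩
        rw [pow_add, pow_add, mul_assoc, ← mul_assoc (v ^ b), pow_conj h]
        simp only [mul_assoc] }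
  have hMfin : (M : Set D).Finite := by
    have h1 : ((fun q : ℕ × ℕ => x ^ q.1 * v ^ q.2) ''
        (((Finset.range (orderOf x)) ×ˢ (Finset.range (orderOf v)) : Finset (ℕ × ℕ)) : Set (ℕ × ℕ))).Finite :=
      (Finset.finite_toSet _).image _
    refine h1.subset ?_
    rintro _ ⟨a, b, rfl⟩
    refine ⟨(a % orderOf x, b % orderOf v), ?_, ?_⟩
    · simp [Nat.mod_lt _ hx.orderOf_pos, Nat.mod_lt _ hv.orderOf_pos]
    · simp [pow_mod_orderOf]
  let A := Algebra.adjoin (ZMod p) (M : Set D)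
  have hfg : (Subalgebra.toSubmodule A).FG := by
    rw [Algebra.adjoin_eq_span, Submonoid.closure_eq]
    exact Submodule.fg_span hMfin
  have hmf : Module.Finite (ZMod p) A := Module.Finite.iff_fg.2 hfg
  have hAf : Finite A := Module.finite_of_finite (ZMod p)
  have hfield := Finite.isDomain_to_isField A
  have hxA : x ∈ A := Algebra.subset_adjoin ⟨1, 0, by simp⟩
  have hvA : v ∈ A := Algebra.subset_adjoin ⟨0, 1, by simp⟩
  exact congrArg Subtype.val (hfield.mul_comm ⟨x, hxA⟩ ⟨v, hvA⟩)

theorem exists_pow_commute {D : Type*} [DivisionRing D] {x v : D} (hv : v ≠ 0)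
    {i : ℕ} (h : v * x = x ^ i * v) (hx : IsOfFinOrder x) :
    ∃ m, 0 < m ∧ x * v ^ m = v ^ m * x := by
  have hfin : (Set.range fun b : ℕ => x ^ (i ^ b)).Finite := by
    refine (Set.Finite.image (fun a => x ^ a) (Set.finite_lt_nat (orderOf x))).subset ?_
    rintro _ ⟨b, rfl⟩
    exact ⟨i ^ b % orderOf x, Nat.mod_lt _ hx.orderOf_pos, pow_mod_orderOf _ _⟩
  have hni : ¬ Function.Injective fun b : ℕ => x ^ (i ^ b) := fun hinj =>
    (Set.infinite_range_of_injective hinj) hfin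
  simp only [Function.Injective, not_forall] at hni
  obtain ⟨a, b, hab, hne⟩ := hni
  wlog hlt : a < b generalizing a b
  · exact this b a hab.symm (fun h => hne h.symm) (by omega)
  refine ⟨b - a, by omega, ?_⟩
  have ha := pow_conj h a 1
  have hb := pow_conj h b 1
  simp only [pow_one, mul_one] at ha hb
  rw [← hab] at hb
  have hba : v ^ b = v ^ a * v ^ (b - a) := by rw [← pow_add]; congr 1; omega
  apply mul_left_cancel₀ (pow_ne_zero a hv)
  rw [← mul_assoc, ha, mul_assoc, ← hba, ← hb, hba, mul_assoc]

/-- The centralizer of an element, as a division ring. -/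
noncomputable def centDiv {D : Type*} [DivisionRing D] (w : D) :
    DivisionRing (Subring.centralizer ({w} : Set D)) :=
  DivisionRing.ofIsUnitOrEqZero (by
    rintro ⟨a, ha⟩
    by_cases h : a = 0
    · right; ext1; exact h
    · left
      rw [Subring.mem_centralizer_iff] at ha
      have hw := ha w rfl
      have hi : a⁻¹ ∈ Subring.centralizer ({w} : Set D) := by
        rw [Subring.mem_centralizer_iff]
        rintro _ rfl
        exact (Commute.inv_right₀ hw).eq
      exact ⟨⟨⟨a, _⟩, ⟨a⁻¹, hi⟩, Subtype.ext (mul_inv_cancel₀ h), Subtype.ext (inv_mul_cancel₀ h)⟩, rfl⟩)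

/-- Herstein: a finite subnormal subgroup of the multiplicative group of a
division ring is central. -/
theorem subnormal_finite_subset_center {D : Type*} [DivisionRing D]
    (G : Subgroup Dˣ) (hG : IsSubnormal G) (hfin : Finite ↥G) :
    ∀ x ∈ G, (x : D) ∈ Subring.center D := by
  intro g hg
  by_contra hnc
  obtain ⟨z, hz⟩ : ∃ z : D, (g : D) * z ≠ z * g := by
    by_contra! hcon
    exact hnc (Subring.mem_center_iff.2 fun z => (hcon z).symm)
  have hgo : IsOfFinOrder (g : D) := by
    have h1 : IsOfFinOrder (⟨g, hg⟩ : G) := isOfFinOrder_of_finite _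
    obtain ⟨n, hn, h2⟩ := isOfFinOrder_iff_pow_eq_one.1 h1
    refine isOfFinOrder_iff_pow_eq_one.2 ⟨n, hn, ?_⟩
    have := congrArg (fun y : G => ((y : Dˣ) : D)) h2
    simpa using this
  have hpos := hgo.orderOf_pos
  obtain ⟨p, hp⟩ := CharP.exists D
  rcases CharP.char_is_prime_or_zero D p with hpp | rfl
  · haveI : Fact p.Prime := ⟨hpp⟩
    have hn := order_ne_zero p hpos
    obtain ⟨i, v, hv, hvx, hix⟩ := eigen_exists g.ne_zero hn rfl hz
    have hnc' : (g : D) * v ≠ v * g := by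
      intro h
      rw [hvx] at h
      exact hix (mul_right_cancel₀ hv h).symm
    obtain ⟨m, hm, hcm⟩ := exists_pow_commute hv hvx hgo
    have hvo : ¬ IsOfFinOrder (v ^ m) := by
      intro h
      exact hnc' (comm_of_finOrder p hvx hgo ((isOfFinOrder_pow.1 h).resolve_right hm.ne'))
    have hinj : Function.Injective fun n : ℕ => (v ^ m) ^ n := by
      intro a b hab
      by_contra hne
      apply hvo
      wlog hlt : a < b generalizing a b
      · exact this hab.symm (fun h => hne h.symm) (by omega)
      refine isOfFinOrder_iff_pow_eq_one.2 ⟨b - a, by omega, ?_⟩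
      apply mul_left_cancel₀ (pow_ne_zero a (pow_ne_zero m hv))
      rw [← pow_add, mul_one, Nat.add_sub_cancel' hlt.le]
      exact hab.symm
    letI := centDiv (v ^ m)
    have hmem : ∀ {y : D}, v ^ m * y = y * v ^ m →
        y ∈ Subring.centralizer ({v ^ m} : Set D) := by
      intro y hy
      rw [Subring.mem_centralizer_iff]
      rintro _ rfl
      exact hy
    let R := Subring.centralizer ({v ^ m} : Set D)
    let φ : R →+* D := R.subtype
    refine contra_of_hom (D₁ := R) φ G hG hfin (fun n => ⟨(v ^ m) ^ n, hmem (by rw [← pow_succ, ← pow_succ'])⟩)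
      (fun a b h => hinj (congrArg Subtype.val h)) ?_ (x := ⟨g, hmem hcm.symm⟩)
      (z := ⟨v, hmem (by rw [← pow_succ, ← pow_succ'])⟩) ?_ (n := orderOf (g : D)) ?_ ?_ ?_ g hg rfl
    · intro n d
      apply Subtype.ext
      have := Subring.mem_centralizer_iff.1 d.2 (v ^ m) rfl
      exact ((show Commute (v ^ m) (d : D) from this).pow_left n).symm.eq
    · intro h
      exact g.ne_zero (congrArg Subtype.val h)
    · intro h
      apply hn
      have := congrArg φ h
      rwa [map_natCast, map_zero] at this
    · apply Subtype.ext
      exact pow_orderOf_eq_one (g : D)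
    · intro h
      exact hnc' (congrArg Subtype.val h)
  · haveI : CharZero D := CharP.charP_to_charZero D
    exact contra_of_hom (RingHom.id D) G hG hfin (fun n => (n : D)) Nat.cast_injective
      (fun n d => (Nat.cast_commute n d).symm) g.ne_zero (n := orderOf (g : D))
      (by exact_mod_cast hpos.ne') (pow_orderOf_eq_one _) hz g hg rfl
end
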